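/- Let d ≥ 1, let k ≥ 2 be an integer, and let s < min(d/2 − 2/(k−1), 0). Fix (u₀,u₁) ∈ 𝓗^s(ℝ^d). Then for every ε > 0 there exist initial data (v₀,v₁) ∈ F⃗L¹ ∩ 𝓗^s, a time T > 0, a Duhamel solution u ∈ C([0,T]; FL^{0,1}(ℝ^d)) of vNLW with initial data (v₀,v₁), and a time t_ε ∈ (0, ε) with t_ε ≤ T, such that ‖(v₀,v₁) − (u₀,u₁)‖_{𝓗^s} < ε and ‖u(t_ε)‖_{H^s} > 1/ε. -/

import Mathlib

open MeasureTheory Real Set Filter Topology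
open scoped ENNReal NNReal BigOperators

noncomputable section

/-- Frequency space `ℝ^d` with the Euclidean norm. -/
abbrev Edim (d : ℕ) := EuclideanSpace ℝ (Fin d)

/-! We work entirely on the Fourier side: a function `f` on `ℝ^d` is represented by
its Fourier transform `F = f̂ : ℝ^d → ℂ`. -/

/-- Squared `H^s` norm, computed on the Fourier side:
`‖f‖_{H^s}² = ∫ ⟨ξ⟩^{2s} |f̂(ξ)|² dξ`. -/
def HsNormSq (d : ℕ) (s : ℝ) (F : Edim d → ℂ) : ℝ≥0∞ :=
  ∫⁻ ξ, ENNReal.ofReal ((1 + ‖ξ‖ ^ 2) ^ s * ‖F ξ‖ ^ 2)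

/-- `H^s` norm on the Fourier side. -/
def HsNorm (d : ℕ) (s : ℝ) (F : Edim d → ℂ) : ℝ≥0∞ :=
  HsNormSq d s F ^ (1 / 2 : ℝ)

/-- Norm of `𝓗^s = H^s × H^{s-1}` on the Fourier side. -/
def pairHsNorm (d : ℕ) (s : ℝ) (F G : Edim d → ℂ) : ℝ≥0∞ :=
  (HsNormSq d s F + HsNormSq d (s - 1) G) ^ (1 / 2 : ℝ)

/-- Membership in `H^s`, on the Fourier side. -/
def MemHs (d : ℕ) (s : ℝ) (F : Edim d → ℂ) : Prop :=
  Measurable F ∧ HsNormSq d s F < ⊤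

/-- Membership in `𝓗^s = H^s × H^{s-1}`, on the Fourier side. -/
def MemHsPair (d : ℕ) (s : ℝ) (F G : Edim d → ℂ) : Prop :=
  MemHs d s F ∧ MemHs d (s - 1) G

/-- The Wiener-algebra norm `‖f‖_{FL^{0,1}} = ‖f̂‖_{L¹}`, on the Fourier side. -/
def FLNorm (d : ℕ) (F : Edim d → ℂ) : ℝ≥0∞ :=
  ∫⁻ ξ, (‖F ξ‖₊ : ℝ≥0∞)

/-- The norm `‖g‖_{FL^{-1,1}} = ‖⟨ξ⟩⁻¹ ĝ‖_{L¹}`, on the Fourier side. -/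
def FLm1Norm (d : ℕ) (F : Edim d → ℂ) : ℝ≥0∞ :=
  ∫⁻ ξ, ENNReal.ofReal ((1 + ‖ξ‖ ^ 2) ^ (-(1 : ℝ) / 2) * ‖F ξ‖)

/-- Norm of `F⃗L¹ = FL^{0,1} × FL^{-1,1}`. -/
def pairFLNorm (d : ℕ) (F G : Edim d → ℂ) : ℝ≥0∞ :=
  FLNorm d F + FLm1Norm d G

/-- Membership in `F⃗L¹ = FL^{0,1} × FL^{-1,1}`, on the Fourier side. -/
def MemFLPair (d : ℕ) (F G : Edim d → ℂ) : Prop :=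
  Measurable F ∧ Measurable G ∧ pairFLNorm d F G < ⊤

/-- Symbol of `V₀(t)`: `cos((√3/2)|ξ|t) + (1/√3) sin((√3/2)|ξ|t)`. -/
def V0sym (t r : ℝ) : ℝ :=
  Real.cos (Real.sqrt 3 / 2 * r * t) + 1 / Real.sqrt 3 * Real.sin (Real.sqrt 3 / 2 * r * t)

/-- Symbol of `V₁(t)`: `sin((√3/2)|ξ|t) / ((√3/2)|ξ|)`. -/
def V1sym (t r : ℝ) : ℝ :=
  Real.sin (Real.sqrt 3 / 2 * r * t) / (Real.sqrt 3 / 2 * r)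

/-- Symbol of the Poisson kernel `P(t)`: `e^{-|ξ|t/2}`. -/
def Psym (t r : ℝ) : ℝ := Real.exp (-(r * t) / 2)

/-- Symbol of `W(t) = P(t)V₁(t)`. -/
def Wsym (t r : ℝ) : ℝ := Psym t r * V1sym t r

/-- Fourier side of the linear flow `V(t)(u₀,u₁) = P(t)(V₀(t)u₀ + V₁(t)u₁)`. -/
def Vflow (d : ℕ) (F₀ F₁ : Edim d → ℂ) (t : ℝ) (ξ : Edim d) : ℂ :=
  ((Psym t ‖ξ‖ * V0sym t ‖ξ‖ : ℝ) : ℂ) * F₀ ξ + ((Psym t ‖ξ‖ * V1sym t ‖ξ‖ : ℝ) : ℂ) * F₁ ξ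

/-- Convolution on `ℝ^d`. -/
def conv (d : ℕ) (f g : Edim d → ℂ) (ξ : Edim d) : ℂ :=
  ∫ η, f (ξ - η) * g η

/-- `convIter d f n` is the `(n+1)`-fold convolution `f ∗ ⋯ ∗ f`. -/
def convIter (d : ℕ) (f : Edim d → ℂ) : ℕ → Edim d → ℂ
  | 0 => f
  | n + 1 => conv d (convIter d f n) f

/-- Convolution of a (nonempty) list of functions. -/
def listConv (d : ℕ) : List (Edim d → ℂ) → Edim d → ℂ
  | [] => fun _ => 0
  | f :: fs => fs.foldl (conv d) f

/-- Fourier side of the Duhamel operator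
`I_k(u₁,…,u_k)(t) = -∫₀ᵗ W(t-t') ∏ u_j(t') dt'`. -/
def Ik (d k : ℕ) (us : Fin k → ℝ → Edim d → ℂ) (t : ℝ) (ξ : Edim d) : ℂ :=
  -(∫ t' in (0 : ℝ)..t,
      ((Wsym (t - t') ‖ξ‖ : ℝ) : ℂ) * listConv d (List.ofFn fun i => us i t') ξ)

/-- Picard iterates `Ξ_j` of vNLW, on the Fourier side:
`Ξ₀(u⃗₀)(t) = V(t)u⃗₀` and
`Ξ_j(u⃗₀) = ∑_{j₁+⋯+j_k = j-1} I_k(Ξ_{j₁}(u⃗₀),…,Ξ_{j_k}(u⃗₀))`. -/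
def Xi (d k : ℕ) (F₀ F₁ : Edim d → ℂ) : ℕ → ℝ → Edim d → ℂ
  | 0 => Vflow d F₀ F₁
  | j + 1 => fun t ξ =>
      ∑ l ∈ (Finset.Nat.antidiagonalTuple k j).attach,
        Ik d k (fun i => Xi d k F₀ F₁ (l.1 i)) t ξ
  decreasing_by
    have h := Finset.Nat.mem_antidiagonalTuple.mp l.2
    have hle := Finset.single_le_sum (f := l.1) (fun j _ => Nat.zero_le (l.1 j))
      (Finset.mem_univ i)
    omega

/-- `u : [0,T] → FL^{0,1}(ℝ^d)` (represented on the Fourier side) is a Duhamel solution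
of vNLW with nonlinearity `-u^k` and initial data `(u₀,u₁)` with `û₀ = F₀`, `û₁ = F₁`. -/
structure IsDuhamelSolution (d k : ℕ) (T : ℝ) (F₀ F₁ : Edim d → ℂ)
    (u : ℝ → Edim d → ℂ) : Prop where
  measurable : ∀ t ∈ Set.Icc (0 : ℝ) T, Measurable (u t)
  finite : ∀ t ∈ Set.Icc (0 : ℝ) T, FLNorm d (u t) < ⊤
  continuous : ∀ t₀ ∈ Set.Icc (0 : ℝ) T, ∀ ε : ℝ, 0 < ε → ∃ δ : ℝ, 0 < δ ∧
    ∀ t ∈ Set.Icc (0 : ℝ) T, |t - t₀| < δ →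
      FLNorm d (fun ξ => u t ξ - u t₀ ξ) < ENNReal.ofReal ε
  duhamel : ∀ t ∈ Set.Icc (0 : ℝ) T, ∀ᵐ ξ : Edim d, u t ξ =
    ((Psym t ‖ξ‖ * V0sym t ‖ξ‖ : ℝ) : ℂ) * F₀ ξ
      + ((Psym t ‖ξ‖ * V1sym t ‖ξ‖ : ℝ) : ℂ) * F₁ ξ
      - ∫ t' in (0 : ℝ)..t,
          ((Wsym (t - t') ‖ξ‖ : ℝ) : ℂ) * convIter d (u t') (k - 1) ξ

/-- The cube `Q_A = [-A/8, A/8]^d`. -/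
def cubeSet (d : ℕ) (A : ℝ) : Set (Edim d) := {ξ | ∀ i, |ξ i| ≤ A / 8}

/-- `Ω = ⋃_{η ∈ Σ} (η + Q_A)` with `Σ = {-2Ne₁, -Ne₁, Ne₁, 2Ne₁}`. -/
def OmegaSet (d : ℕ) (N A : ℝ) : Set (Edim d) :=
  {ξ | ∃ c : ℝ, (c = -2 * N ∨ c = -N ∨ c = N ∨ c = 2 * N) ∧
    ∀ i : Fin d, |ξ i - (if (i : ℕ) = 0 then c else 0)| ≤ A / 8}

/-- `Ω_k = ⋃_{η ∈ Σ_k} (η + Q_A)` with `Σ_k = {-Ne₁, Ne₁}` for even `k` and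
`Σ_k = {-2Ne₁, -Ne₁, Ne₁, 2Ne₁}` for odd `k`. -/
def OmegaKSet (d k : ℕ) (N A : ℝ) : Set (Edim d) :=
  {ξ | ∃ c : ℝ, (if k % 2 = 0 then c = -N ∨ c = N
      else c = -2 * N ∨ c = -N ∨ c = N ∨ c = 2 * N) ∧
    ∀ i : Fin d, |ξ i - (if (i : ℕ) = 0 then c else 0)| ≤ A / 8}

/-- `φ̂ = R·𝟙_Ω`. -/
def phiHat (d : ℕ) (N A R : ℝ) : Edim d → ℂ :=
  Set.indicator (OmegaSet d N A) fun _ => (R : ℂ)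

/-- `φ̂ = R·𝟙_{Ω_k}`. -/
def phiHatK (d k : ℕ) (N A R : ℝ) : Edim d → ℂ :=
  Set.indicator (OmegaKSet d k N A) fun _ => (R : ℂ)

/-- `g_s(A)`: `1` if `s < -d/2`; `(log⟨A⟩)^{1/2}` if `s = -d/2`; `A^{d/2+s}` if `s > -d/2`. -/
def gs (d : ℕ) (s A : ℝ) : ℝ :=
  if s < -(d : ℝ) / 2 then 1
  else if s = -(d : ℝ) / 2 then Real.sqrt (Real.log (Real.sqrt (1 + A ^ 2)))
  else A ^ ((d : ℝ) / 2 + s)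


section Abstract

variable {X : Type*} [NormedAddCommGroup X]

/-- The left-normed powers `B(⋯B(B(x, x), x)⋯, x)` of `x` for a product `B`; `bpow B x n` has `n + 1`
factors. -/
def bpow (B : X → X → X) (x : X) : ℕ → X
  | 0 => x
  | n + 1 => B (bpow B x n) x

lemma norm_bpow_le {B : X → X → X} (hB : ∀ x y, ‖B x y‖ ≤ ‖x‖ * ‖y‖) (x : X) (n : ℕ) :
    ‖bpow B x n‖ ≤ ‖x‖ ^ (n + 1) := by
  induction n with
  | zero => simp [bpow]
  | succ n ih =>
    calc ‖B (bpow B x n) x‖ ≤ ‖bpow B x n‖ * ‖x‖ := hB _ _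
      _ ≤ ‖x‖ ^ (n + 1) * ‖x‖ := by gcongr
      _ = ‖x‖ ^ (n + 1 + 1) := by ring

lemma norm_bpow_sub_le {B : X → X → X} (hB : ∀ x y, ‖B x y‖ ≤ ‖x‖ * ‖y‖)
    (hl : ∀ x x' y, B (x - x') y = B x y - B x' y) (hr : ∀ x y y', B x (y - y') = B x y - B x y')
    {x y : X} {r : ℝ} (hx : ‖x‖ ≤ r) (hy : ‖y‖ ≤ r) (n : ℕ) :
    ‖bpow B x n - bpow B y n‖ ≤ (n + 1) * r ^ n * ‖x - y‖ := by
  have hr0 : 0 ≤ r := (norm_nonneg x).trans hx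
  induction n with
  | zero => simp [bpow]
  | succ n ih =>
    have e : B (bpow B x n) x - B (bpow B y n) y
        = B (bpow B x n - bpow B y n) x + B (bpow B y n) (x - y) := by
      rw [hl, hr]; abel
    have h1 : ‖bpow B y n‖ ≤ r ^ (n + 1) := (norm_bpow_le hB y n).trans (by gcongr)
    calc ‖B (bpow B x n) x - B (bpow B y n) y‖
        ≤ ‖bpow B x n - bpow B y n‖ * ‖x‖ + ‖bpow B y n‖ * ‖x - y‖ := by
          rw [e]; exact (norm_add_le _ _).trans (add_le_add (hB _ _) (hB _ _))
      _ ≤ ((n + 1) * r ^ n * ‖x - y‖) * r + r ^ (n + 1) * ‖x - y‖ := by gcongr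
      _ = ((n + 1 : ℕ) + 1) * r ^ (n + 1) * ‖x - y‖ := by push_cast; ring

lemma exists_fixedPoint_sub_bpow [CompleteSpace X] {B : X → X → X} {D : X → X} {τ ρ : ℝ}
    (hB : ∀ x y, ‖B x y‖ ≤ ‖x‖ * ‖y‖)
    (hl : ∀ x x' y, B (x - x') y = B x y - B x' y) (hr : ∀ x y y', B x (y - y') = B x y - B x y')
    (hD : ∀ x, ‖D x‖ ≤ τ * ‖x‖) (hDs : ∀ x y, D (x - y) = D x - D y) (hτ : 0 ≤ τ)
    {n : ℕ} (hsmall : τ * (n + 1) * (2 * ρ) ^ n ≤ 1 / 2) {x₀ : X} (hx₀ : ‖x₀‖ ≤ ρ) :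
    ∃ u, ‖u‖ ≤ 2 * ρ ∧ u = x₀ - D (bpow B u n) := by
  have hρ : 0 ≤ ρ := (norm_nonneg _).trans hx₀
  set Φ : X → X := fun u => x₀ - D (bpow B u n) with hΦ
  have hmaps : MapsTo Φ (Metric.closedBall 0 (2 * ρ)) (Metric.closedBall 0 (2 * ρ)) := by
    intro u hu
    rw [mem_closedBall_zero_iff] at hu ⊢
    have h1 : ‖bpow B u n‖ ≤ (2 * ρ) ^ (n + 1) := (norm_bpow_le hB u n).trans (by gcongr)
    have h2 : τ * (2 * ρ) ^ n ≤ 1 / 2 := by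
      refine le_trans ?_ hsmall
      gcongr
      nlinarith [(Nat.cast_nonneg n : (0 : ℝ) ≤ n)]
    calc ‖Φ u‖ ≤ ‖x₀‖ + ‖D (bpow B u n)‖ := norm_sub_le _ _
      _ ≤ ρ + τ * (2 * ρ) ^ (n + 1) := by
          gcongr
          exact (hD _).trans (by gcongr)
      _ = ρ + (τ * (2 * ρ) ^ n) * (2 * ρ) := by ring
      _ ≤ ρ + 1 / 2 * (2 * ρ) := by gcongr
      _ = 2 * ρ := by ring
  have hcontr : ContractingWith (1 / 2 : ℝ≥0) (hmaps.restrict Φ _ _) := by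
    refine ⟨by rw [← NNReal.coe_lt_coe]; norm_num, LipschitzWith.of_dist_le_mul ?_⟩
    rintro ⟨u, hu⟩ ⟨v, hv⟩
    rw [mem_closedBall_zero_iff] at hu hv
    rw [Subtype.dist_eq, Subtype.dist_eq, dist_eq_norm, dist_eq_norm]
    have e : Φ u - Φ v = -D (bpow B u n - bpow B v n) := by
      simp only [hΦ, hDs]; abel
    change ‖Φ u - Φ v‖ ≤ _ * ‖u - v‖
    rw [e, norm_neg]
    calc ‖D (bpow B u n - bpow B v n)‖ ≤ τ * ((n + 1) * (2 * ρ) ^ n * ‖u - v‖) :=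
          (hD _).trans (by gcongr; exact norm_bpow_sub_le hB hl hr hu hv n)
      _ = (τ * (n + 1) * (2 * ρ) ^ n) * ‖u - v‖ := by ring
      _ ≤ 1 / 2 * ‖u - v‖ := by gcongr
      _ = _ := by norm_num
  obtain ⟨u, hu, hfix, -⟩ := hcontr.exists_fixedPoint' (x := 0) Metric.isClosed_closedBall.isComplete
    hmaps (by simp [hρ]) (edist_ne_top _ _)
  exact ⟨u, mem_closedBall_zero_iff.1 hu, hfix.symm⟩

end Abstract

section L1Convolution

variable {G : Type*} [NormedAddCommGroup G] [MeasurableSpace G] [BorelSpace G]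
  [SecondCountableTopology G] {μ : Measure G} [SFinite μ] [μ.IsAddLeftInvariant]
  {E : Type*} [NormedRing E] [NormedAlgebra ℝ E]

lemma integrable_l1conv (f g : G →₁[μ] E) :
    Integrable (convolution f g (ContinuousLinearMap.mul ℝ E) μ) μ :=
  (L1.integrable_coeFn f).integrable_convolution _ (L1.integrable_coeFn g)

/-- Convolution on `L¹` with values in a normed algebra. -/
def l1conv (f g : G →₁[μ] E) : G →₁[μ] E := (integrable_l1conv f g).toL1 _

lemma ae_comp_sub_left {p : G → Prop} (h : ∀ᵐ η ∂μ, p η) (ξ : G) : ∀ᵐ η ∂μ, p (ξ - η) :=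
  (quasiMeasurePreserving_sub_left_of_right_invariant μ ξ).ae h

variable [μ.IsNegInvariant]

lemma coeFn_l1conv (f g : G →₁[μ] E) :
    l1conv f g =ᵐ[μ] fun ξ => ∫ η, f (ξ - η) * g η ∂μ := by
  filter_upwards [Integrable.coeFn_toL1 (integrable_l1conv f g)] with ξ h
  rw [l1conv, h, convolution_eq_swap]
  rfl

lemma ae_integrable_mul_sub {f g : G → E} (hf : Integrable f μ) (hg : Integrable g μ) :
    ∀ᵐ ξ ∂μ, Integrable (fun η => f (ξ - η) * g η) μ := by
  filter_upwards [hf.ae_convolution_exists (ContinuousLinearMap.mul ℝ E) hg] with ξ h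
  exact h.integrable_swap

lemma norm_l1conv_le (f g : G →₁[μ] E) : ‖l1conv f g‖ ≤ ‖f‖ * ‖g‖ := by
  have hf := L1.integrable_coeFn f
  have hg := L1.integrable_coeFn g
  have hi := hf.norm.integrable_convolution (ContinuousLinearMap.mul ℝ ℝ) hg.norm
  rw [L1.norm_eq_integral_norm, L1.norm_eq_integral_norm f, L1.norm_eq_integral_norm g]
  have h := integral_convolution (μ := μ) (ν := μ) (ContinuousLinearMap.mul ℝ ℝ) hf.norm hg.norm
  simp only [ContinuousLinearMap.mul_apply'] at h
  rw [← h]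
  refine integral_mono_ae (L1.integrable_coeFn _).norm hi ?_
  filter_upwards [coeFn_l1conv f g, ae_integrable_mul_sub hf.norm hg.norm] with ξ h1 h2
  rw [h1, convolution_eq_swap]
  refine (norm_integral_le_integral_norm _).trans ?_
  refine integral_mono_of_nonneg (Eventually.of_forall fun _ => norm_nonneg _) h2
    (Eventually.of_forall fun η => norm_mul_le _ _)

lemma l1conv_sub_left (f f' g : G →₁[μ] E) : l1conv (f - f') g = l1conv f g - l1conv f' g := by
  refine Lp.ext ?_
  have hg := L1.integrable_coeFn g
  filter_upwards [coeFn_l1conv (f - f') g, coeFn_l1conv f g, coeFn_l1conv f' g,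
    Lp.coeFn_sub (l1conv f g) (l1conv f' g), ae_integrable_mul_sub (L1.integrable_coeFn f) hg,
    ae_integrable_mul_sub (L1.integrable_coeFn f') hg] with ξ h1 h2 h3 h4 h5 h6
  rw [h1, h4, Pi.sub_apply, h2, h3, ← integral_sub h5 h6]
  refine integral_congr_ae ?_
  filter_upwards [ae_comp_sub_left (Lp.coeFn_sub f f') ξ] with η h
  rw [h, Pi.sub_apply, sub_mul]

lemma l1conv_sub_right (f g g' : G →₁[μ] E) : l1conv f (g - g') = l1conv f g - l1conv f g' := by
  refine Lp.ext ?_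
  have hf := L1.integrable_coeFn f
  filter_upwards [coeFn_l1conv f (g - g'), coeFn_l1conv f g, coeFn_l1conv f g',
    Lp.coeFn_sub (l1conv f g) (l1conv f g'), ae_integrable_mul_sub hf (L1.integrable_coeFn g),
    ae_integrable_mul_sub hf (L1.integrable_coeFn g')] with ξ h1 h2 h3 h4 h5 h6
  rw [h1, h4, Pi.sub_apply, h2, h3, ← integral_sub h5 h6]
  refine integral_congr_ae ?_
  filter_upwards [Lp.coeFn_sub g g'] with η h
  rw [h, Pi.sub_apply, mul_sub]

end L1Convolution

section Kernels

/-- The symbol of `W(t)`, extended continuously to the zero frequency. -/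
def Wcont (t r : ℝ) : ℝ := Real.exp (-(r * t) / 2) * (t * Real.sinc (Real.sqrt 3 / 2 * r * t))

lemma Wsym_eq_Wcont {r : ℝ} (hr : r ≠ 0) (t : ℝ) : Wsym t r = Wcont t r := by
  rcases eq_or_ne t 0 with rfl | ht
  · simp [Wsym, Wcont, V1sym]
  · have h3 : Real.sqrt 3 ≠ 0 := by positivity
    rw [Wsym, Wcont, Psym, V1sym, Real.sinc_of_ne_zero (by positivity)]
    field_simp

lemma continuous_Wcont : Continuous fun p : ℝ × ℝ => Wcont p.1 p.2 := by
  have := Real.continuous_sinc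
  unfold Wcont
  fun_prop

lemma abs_Wcont_le {t r : ℝ} (ht : 0 ≤ t) (hr : 0 ≤ r) : |Wcont t r| ≤ t := by
  rw [Wcont, abs_mul, abs_mul, abs_of_pos (Real.exp_pos _), abs_of_nonneg ht]
  have h1 : Real.exp (-(r * t) / 2) ≤ 1 := Real.exp_le_one_iff.2 (by nlinarith [mul_nonneg hr ht])
  have h2 := Real.abs_sinc_le_one (Real.sqrt 3 / 2 * r * t)
  calc _ ≤ 1 * (t * 1) := by gcongr
    _ = t := by ring

lemma sqrt_three_div_two_le_one : Real.sqrt 3 / 2 ≤ 1 := by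
  have : Real.sqrt 3 ≤ 2 := Real.sqrt_le_iff.2 (by norm_num)
  linarith

lemma half_le_Wcont {t r : ℝ} (ht : 0 ≤ t) (hr : 0 ≤ r) (hrt : r * t ≤ 1 / 2) :
    t / 2 ≤ Wcont t r := by
  have hy : 0 ≤ r * t := mul_nonneg hr ht
  have h1 : 3 / 4 ≤ Real.exp (-(r * t) / 2) := by
    have := Real.add_one_le_exp (-(r * t) / 2)
    linarith
  have h2 : 3 / 4 ≤ Real.sinc (Real.sqrt 3 / 2 * r * t) := by
    set x := Real.sqrt 3 / 2 * r * t with hx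
    have hx1 : x ≤ 1 / 2 := by
      rw [hx, mul_assoc]
      nlinarith [sqrt_three_div_two_le_one]
    rcases eq_or_lt_of_le (show 0 ≤ x by positivity) with h0 | h0
    · rw [← h0]; norm_num
    · rw [Real.sinc_of_ne_zero h0.ne', le_div_iff₀ h0]
      have := Real.sin_gt_sub_cube h0
      nlinarith [mul_pos h0 h0, mul_pos h0 (mul_pos h0 h0)]
  rw [Wcont]
  have : 3 / 4 * (t * (3 / 4)) ≤ Real.exp (-(r * t) / 2) * (t * Real.sinc (Real.sqrt 3 / 2 * r * t)) := by
    gcongr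
  linarith

/-- The symbol of `P(t)V₀(t)`. -/
def PV0 (t r : ℝ) : ℝ := Psym t r * V0sym t r

lemma continuous_PV0 : Continuous fun p : ℝ × ℝ => PV0 p.1 p.2 := by
  unfold PV0 Psym V0sym
  fun_prop

lemma abs_V0sym_le (t r : ℝ) : |V0sym t r| ≤ 2 := by
  have h1 := Real.abs_cos_le_one (Real.sqrt 3 / 2 * r * t)
  have h2 := Real.abs_sin_le_one (Real.sqrt 3 / 2 * r * t)
  have h3 : |1 / Real.sqrt 3| ≤ 1 := by
    rw [abs_of_nonneg (by positivity), div_le_one (by positivity)]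
    exact Real.one_le_sqrt.2 (by norm_num)
  calc |V0sym t r| ≤ |Real.cos (Real.sqrt 3 / 2 * r * t)|
        + |1 / Real.sqrt 3 * Real.sin (Real.sqrt 3 / 2 * r * t)| := abs_add_le _ _
    _ ≤ 1 + 1 * 1 := by rw [abs_mul]; gcongr
    _ = 2 := by norm_num

lemma abs_PV0_le {t r : ℝ} (ht : 0 ≤ t) (hr : 0 ≤ r) : |PV0 t r| ≤ 2 := by
  rw [PV0, Psym, abs_mul, abs_of_pos (Real.exp_pos _)]
  have h1 : Real.exp (-(r * t) / 2) ≤ 1 := Real.exp_le_one_iff.2 (by nlinarith [mul_nonneg hr ht])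
  have h2 := abs_V0sym_le t r
  calc Real.exp (-(r * t) / 2) * |V0sym t r| ≤ 1 * 2 := by gcongr
    _ = 2 := by norm_num

lemma abs_PV0_sub_one_le {t r : ℝ} (ht : 0 ≤ t) (hr : 0 ≤ r) (hrt : r * t ≤ 1) :
    |PV0 t r - 1| ≤ 3 * (r * t) := by
  have hy : 0 ≤ r * t := mul_nonneg hr ht
  set y := r * t with hyd
  have h1 : |Psym t r - 1| ≤ y / 2 := by
    rw [Psym, ← hyd]
    have h1 := Real.add_one_le_exp (-y / 2)
    have h2 : Real.exp (-y / 2) ≤ 1 := Real.exp_le_one_iff.2 (by linarith)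
    rw [abs_le]; constructor <;> linarith
  set x := Real.sqrt 3 / 2 * r * t with hx
  have hxy : x = Real.sqrt 3 / 2 * y := by rw [hx, hyd]; ring
  have hx0 : 0 ≤ x := by rw [hxy]; positivity
  have hx1 : x ≤ y := by rw [hxy]; nlinarith [sqrt_three_div_two_le_one]
  have h2 : |Real.cos x - 1| ≤ y := by
    have h1 := Real.one_sub_sq_div_two_le_cos (x := x)
    have h2 := Real.cos_le_one x
    rw [abs_le]; constructor <;> nlinarith
  have h3 : |1 / Real.sqrt 3 * Real.sin x| ≤ y / 2 := by
    rw [abs_mul, abs_of_nonneg (a := 1 / Real.sqrt 3) (by positivity)]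
    have h4 : |Real.sin x| ≤ x := by
      have := Real.abs_sin_le_abs (x := x)
      rwa [abs_of_nonneg hx0] at this
    calc 1 / Real.sqrt 3 * |Real.sin x| ≤ 1 / Real.sqrt 3 * x := by gcongr
      _ = y / 2 := by
        rw [hxy]
        have : Real.sqrt 3 ≠ 0 := by positivity
        field_simp
  have e : PV0 t r - 1 = (Psym t r - 1) * V0sym t r
      + ((Real.cos x - 1) + 1 / Real.sqrt 3 * Real.sin x) := by
    rw [PV0, V0sym, ← hx]; ring
  rw [e]
  calc _ ≤ |Psym t r - 1| * |V0sym t r| + (|Real.cos x - 1| + |1 / Real.sqrt 3 * Real.sin x|) := by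
        rw [← abs_mul]
        exact (abs_add_le _ _).trans (add_le_add le_rfl (abs_add_le _ _))
    _ ≤ y / 2 * 2 + (y + y / 2) := by
        gcongr
        exact abs_V0sym_le t r
    _ ≤ 3 * y := by linarith

end Kernels

section TimeDependent

variable {T : ℝ}

/-- The linear flow at radial frequency `r` with initial values `a` and `b`, as a continuous
function of time. -/
def linFlow (T : ℝ) : C(ℝ × ℂ × ℂ, C(Icc (0 : ℝ) T, ℂ)) :=
  ContinuousMap.curry ⟨fun p => (PV0 p.2 p.1.1 : ℂ) * p.1.2.1 + (Wcont p.2 p.1.1 : ℂ) * p.1.2.2, by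
    have h1 : Continuous fun p : (ℝ × ℂ × ℂ) × Icc (0 : ℝ) T => PV0 p.2 p.1.1 :=
      continuous_PV0.comp (f := fun p : (ℝ × ℂ × ℂ) × Icc (0 : ℝ) T => ((p.2 : ℝ), p.1.1))
        (by fun_prop)
    have h2 : Continuous fun p : (ℝ × ℂ × ℂ) × Icc (0 : ℝ) T => Wcont p.2 p.1.1 :=
      continuous_Wcont.comp (f := fun p : (ℝ × ℂ × ℂ) × Icc (0 : ℝ) T => ((p.2 : ℝ), p.1.1))
        (by fun_prop)
    fun_prop⟩

lemma linFlow_apply (r : ℝ) (a b : ℂ) (t : Icc (0 : ℝ) T) :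
    linFlow T (r, a, b) t = (PV0 t r : ℂ) * a + (Wcont t r : ℂ) * b := rfl

/-- The Duhamel integral at radial frequency `r`, as a continuous function of time. -/
def duhamel (hT : 0 ≤ T) : C(ℝ × C(Icc (0 : ℝ) T, ℂ), C(Icc (0 : ℝ) T, ℂ)) :=
  ContinuousMap.curry ⟨fun p => ∫ t' in (0 : ℝ)..p.2,
      (Wcont (p.2 - t') p.1.1 : ℂ) * p.1.2 (projIcc 0 T hT t'), by
    refine intervalIntegral.continuous_parametric_intervalIntegral_of_continuous
      (f := fun (p : (ℝ × C(Icc (0 : ℝ) T, ℂ)) × Icc (0 : ℝ) T) t' =>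
        (Wcont (p.2 - t') p.1.1 : ℂ) * p.1.2 (projIcc 0 T hT t')) ?_ (by fun_prop)
    have h2 : Continuous fun q : ((ℝ × C(Icc (0 : ℝ) T, ℂ)) × Icc (0 : ℝ) T) × ℝ =>
        Wcont (q.1.2 - q.2) q.1.1.1 :=
      continuous_Wcont.comp (f := fun q : ((ℝ × C(Icc (0 : ℝ) T, ℂ)) × Icc (0 : ℝ) T) × ℝ =>
        ((q.1.2 : ℝ) - q.2, q.1.1.1)) (by fun_prop)
    have h3 : Continuous fun q : ((ℝ × C(Icc (0 : ℝ) T, ℂ)) × Icc (0 : ℝ) T) × ℝ =>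
        q.1.1.2 (projIcc 0 T hT q.2) := by
      have := continuous_projIcc (h := hT)
      exact ContinuousEval.continuous_eval.comp (f := fun q : ((ℝ × C(Icc (0 : ℝ) T, ℂ)) × Icc (0 : ℝ) T) × ℝ =>
        (q.1.1.2, projIcc 0 T hT q.2)) (by fun_prop)
    change Continuous fun q : ((ℝ × C(Icc (0 : ℝ) T, ℂ)) × Icc (0 : ℝ) T) × ℝ =>
      (Wcont (q.1.2 - q.2) q.1.1.1 : ℂ) * q.1.1.2 (projIcc 0 T hT q.2)
    fun_prop⟩

lemma duhamel_apply (hT : 0 ≤ T) (r : ℝ) (g : C(Icc (0 : ℝ) T, ℂ)) (t : Icc (0 : ℝ) T) :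
    duhamel hT (r, g) t =
      ∫ t' in (0 : ℝ)..t, (Wcont (t - t') r : ℂ) * g (projIcc 0 T hT t') := rfl

lemma continuous_Wcont_sub (t r : ℝ) : Continuous fun t' : ℝ => Wcont (t - t') r :=
  continuous_Wcont.comp (f := fun t' : ℝ => (t - t', r)) (by fun_prop)

lemma duhamel_sub (hT : 0 ≤ T) (r : ℝ) (f g : C(Icc (0 : ℝ) T, ℂ)) :
    duhamel hT (r, f - g) = duhamel hT (r, f) - duhamel hT (r, g) := by
  ext t
  have h (g : C(Icc (0 : ℝ) T, ℂ)) : IntervalIntegrable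
      (fun t' => (Wcont (t - t') r : ℂ) * g (projIcc 0 T hT t')) volume 0 t := by
    have h1 := continuous_Wcont_sub t r
    have h2 := continuous_projIcc (h := hT)
    exact Continuous.intervalIntegrable (by fun_prop) _ _
  rw [ContinuousMap.sub_apply, duhamel_apply, duhamel_apply, duhamel_apply,
    ← intervalIntegral.integral_sub (h f) (h g)]
  simp [mul_sub]

lemma norm_duhamel_le (hT : 0 ≤ T) {r : ℝ} (hr : 0 ≤ r) (g : C(Icc (0 : ℝ) T, ℂ)) :
    ‖duhamel hT (r, g)‖ ≤ T ^ 2 * ‖g‖ := by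
  rw [ContinuousMap.norm_le _ (by positivity)]
  rintro ⟨t, ht0, htT⟩
  rw [duhamel_apply]
  have := intervalIntegral.norm_integral_le_of_norm_le_const (a := 0) (b := t) (C := T * ‖g‖)
    (f := fun t' => (Wcont (t - t') r : ℂ) * g (projIcc 0 T hT t')) (by
      intro x hx
      rw [uIoc_of_le ht0] at hx
      rw [norm_mul, Complex.norm_real, Real.norm_eq_abs]
      gcongr
      · exact (abs_Wcont_le (by linarith [hx.2]) hr).trans (by linarith [hx.1])
      · exact g.norm_coe_le_norm _)
  refine this.trans ?_
  rw [sub_zero, abs_of_nonneg ht0]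
  calc T * ‖g‖ * t ≤ T * ‖g‖ * T := by gcongr
    _ = T ^ 2 * ‖g‖ := by ring

lemma le_norm_duhamel_const (hT : 0 ≤ T) {r : ℝ} (hr : 0 ≤ r) (hrT : r * T ≤ 1 / 2)
    {g : C(Icc (0 : ℝ) T, ℂ)} {c : ℂ} (hg : ∀ t, g t = c) :
    T ^ 2 / 4 * ‖c‖ ≤ ‖duhamel hT (r, g) ⟨T, hT, le_rfl⟩‖ := by
  rw [duhamel_apply]
  simp only [hg, intervalIntegral.integral_mul_const, norm_mul, intervalIntegral.integral_ofReal,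
    Complex.norm_real]
  gcongr
  refine le_trans ?_ (le_abs_self _)
  have h : ∫ t' in (0 : ℝ)..T, (T - t') / 2 = T ^ 2 / 4 := by
    rw [intervalIntegral.integral_div, intervalIntegral.integral_sub (by simp) (by simp)]
    simp only [intervalIntegral.integral_const, integral_id]
    simp
    ring
  rw [← h]
  refine intervalIntegral.integral_mono_on hT (Continuous.intervalIntegrable (by fun_prop) _ _)
    ((continuous_Wcont_sub T r).intervalIntegrable _ _) ?_
  intro x hx
  refine half_le_Wcont (by linarith [hx.2]) hr (le_trans ?_ hrT)
  gcongr
  linarith [hx.1]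

end TimeDependent

section Picard

variable {d : ℕ} {T : ℝ}

lemma ae_bpow_apply_eq_convIter {K : Type*} [TopologicalSpace K] [CompactSpace K]
    (U : Edim d →₁[volume] C(K, ℂ)) (n : ℕ) :
    ∀ᵐ ξ, ∀ t, bpow l1conv U n ξ t = convIter d (fun η => U η t) n ξ := by
  induction n with
  | zero => exact Eventually.of_forall fun ξ t => rfl
  | succ n ih =>
    filter_upwards [coeFn_l1conv (bpow l1conv U n) U,
      ae_integrable_mul_sub (L1.integrable_coeFn (bpow l1conv U n)) (L1.integrable_coeFn U)]
      with ξ h1 h2 t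
    have e := (ContinuousMap.evalCLM ℝ t : C(K, ℂ) →L[ℝ] ℂ).integral_comp_comm h2
    rw [bpow, h1]
    simp only [ContinuousMap.evalCLM_apply, ContinuousMap.mul_apply] at e
    rw [← e, convIter, conv]
    refine integral_congr_ae ?_
    filter_upwards [ae_comp_sub_left ih ξ] with η h
    rw [h]

/-- The Duhamel operator on `L¹` functions with values in the continuous functions of time. -/
def duhamelL1 (hT : 0 ≤ T) (x : Edim d →₁[volume] C(Icc (0 : ℝ) T, ℂ)) :
    Edim d →₁[volume] C(Icc (0 : ℝ) T, ℂ) :=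
  Integrable.toL1 (fun ξ => duhamel hT (‖ξ‖, x ξ)) <| by
    refine Integrable.mono' ((L1.integrable_coeFn x).norm.const_mul (T ^ 2)) ?_
      (Eventually.of_forall fun ξ => norm_duhamel_le hT (norm_nonneg _) _)
    exact (duhamel hT).continuous.comp_aestronglyMeasurable
      (continuous_norm.aestronglyMeasurable.prodMk (L1.aestronglyMeasurable_coeFn x))

lemma coeFn_duhamelL1 (hT : 0 ≤ T) (x : Edim d →₁[volume] C(Icc (0 : ℝ) T, ℂ)) :
    duhamelL1 hT x =ᵐ[volume] fun ξ => duhamel hT (‖ξ‖, x ξ) :=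
  Integrable.coeFn_toL1 _

lemma norm_duhamelL1_le (hT : 0 ≤ T) (x : Edim d →₁[volume] C(Icc (0 : ℝ) T, ℂ)) :
    ‖duhamelL1 hT x‖ ≤ T ^ 2 * ‖x‖ := by
  rw [L1.norm_eq_integral_norm, L1.norm_eq_integral_norm, ← integral_const_mul]
  refine integral_mono_ae (L1.integrable_coeFn _).norm
    ((L1.integrable_coeFn _).norm.const_mul _) ?_
  filter_upwards [coeFn_duhamelL1 hT x] with ξ h
  rw [h]
  exact norm_duhamel_le hT (norm_nonneg _) _

lemma duhamelL1_sub (hT : 0 ≤ T) (x y : Edim d →₁[volume] C(Icc (0 : ℝ) T, ℂ)) :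
    duhamelL1 hT (x - y) = duhamelL1 hT x - duhamelL1 hT y := by
  refine Lp.ext ?_
  filter_upwards [coeFn_duhamelL1 hT (x - y), coeFn_duhamelL1 hT x, coeFn_duhamelL1 hT y,
    Lp.coeFn_sub x y, Lp.coeFn_sub (duhamelL1 hT x) (duhamelL1 hT y)] with ξ h1 h2 h3 h4 h5
  rw [h1, h4, h5, Pi.sub_apply, Pi.sub_apply, h2, h3, duhamel_sub]

end Picard

section Solution

variable {d : ℕ} {T : ℝ}

lemma norm_linFlow_le (hT : 0 ≤ T) {r : ℝ} (hr : 0 ≤ r) (a b : ℂ) :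
    ‖linFlow T (r, a, b)‖ ≤ 2 * ‖a‖ + T * ‖b‖ := by
  rw [ContinuousMap.norm_le _ (by positivity)]
  rintro ⟨t, ht0, htT⟩
  rw [linFlow_apply]
  refine (norm_add_le _ _).trans ?_
  rw [norm_mul, norm_mul, Complex.norm_real, Complex.norm_real, Real.norm_eq_abs, Real.norm_eq_abs]
  gcongr
  · exact abs_PV0_le ht0 hr
  · exact (abs_Wcont_le ht0 hr).trans htT

lemma integrable_linFlow (hT : 0 ≤ T) {G₀ G₁ : Edim d → ℂ} (h0 : Integrable G₀)
    (h1 : Integrable G₁) : Integrable fun ξ => linFlow T (‖ξ‖, G₀ ξ, G₁ ξ) := by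
  refine Integrable.mono' ((h0.norm.const_mul 2).add (h1.norm.const_mul T)) ?_
    (Eventually.of_forall fun ξ => norm_linFlow_le hT (norm_nonneg _) _ _)
  exact (linFlow T).continuous.comp_aestronglyMeasurable
    (continuous_norm.aestronglyMeasurable.prodMk (h0.1.prodMk h1.1))

lemma isDuhamelSolution_of_fixedPoint (hd : 1 ≤ d) (hT : 0 ≤ T) {G₀ G₁ : Edim d → ℂ}
    (h0 : Integrable G₀) (h1 : Integrable G₁) {n : ℕ}
    {U : Edim d →₁[volume] C(Icc (0 : ℝ) T, ℂ)}
    (hU : U = (integrable_linFlow hT h0 h1).toL1 _ - duhamelL1 hT (bpow l1conv U n)) :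
    IsDuhamelSolution d (n + 1) T G₀ G₁ fun t ξ => U ξ (projIcc 0 T hT t) := by
  have hle : ∀ t ξ, ‖U ξ (projIcc 0 T hT t)‖ₑ ≤ ‖U ξ‖ₑ := fun t ξ =>
    enorm_le_iff_norm_le.2 ((U ξ).norm_coe_le_norm _)
  have hfin : ∫⁻ ξ, ‖U ξ‖ₑ < ⊤ := L1.hasFiniteIntegral_coeFn U
  have hsm : ∀ t, StronglyMeasurable fun ξ => U ξ (projIcc 0 T hT t) := fun t =>
    (continuous_eval_const (projIcc 0 T hT t)).comp_stronglyMeasurable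
      (L1.stronglyMeasurable_coeFn U)
  refine ⟨fun t _ => (hsm t).measurable, fun t _ => ?_, fun t₀ _ ε hε => ?_, fun t ht => ?_⟩
  · exact (lintegral_mono fun ξ => hle t ξ).trans_lt hfin
  · have hlim : Tendsto (fun t => FLNorm d fun ξ =>
        U ξ (projIcc 0 T hT t) - U ξ (projIcc 0 T hT t₀)) (𝓝 t₀) (𝓝 (∫⁻ _ : Edim d, 0)) := by
      refine tendsto_lintegral_filter_of_dominated_convergence (fun ξ => 2 * ‖U ξ‖ₑ)
        (Eventually.of_forall fun t => ((hsm t).sub (hsm t₀)).measurable.enorm)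
        (Eventually.of_forall fun t => Eventually.of_forall fun ξ => ?_) ?_
        (Eventually.of_forall fun ξ => ?_)
      · calc _ ≤ ‖U ξ (projIcc 0 T hT t)‖ₑ + ‖U ξ (projIcc 0 T hT t₀)‖ₑ := enorm_sub_le
          _ ≤ ‖U ξ‖ₑ + ‖U ξ‖ₑ := add_le_add (hle _ _) (hle _ _)
          _ = 2 * ‖U ξ‖ₑ := (two_mul _).symm
      · rw [lintegral_const_mul' _ _ (by simp)]
        exact (ENNReal.mul_lt_top (by simp) hfin).ne
      · have hc : Continuous fun t => ‖U ξ (projIcc 0 T hT t) - U ξ (projIcc 0 T hT t₀)‖ₑ := by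
          have := continuous_projIcc (h := hT)
          fun_prop
        have h := hc.tendsto t₀
        simp only [sub_self, enorm_zero] at h
        exact h
    rw [lintegral_zero] at hlim
    have hev := hlim.eventually (gt_mem_nhds (ENNReal.ofReal_pos.2 hε))
    obtain ⟨δ, hδ, h⟩ := Metric.eventually_nhds_iff.1 hev
    exact ⟨δ, hδ, fun t _ ht => h (by rwa [Real.dist_eq])⟩
  · have : Nonempty (Fin d) := ⟨⟨0, hd⟩⟩
    have hne : ∀ᵐ ξ : Edim d, ξ ≠ 0 := by
      simp [ae_iff]
    have hU' : ∀ᵐ ξ, U ξ = ((integrable_linFlow hT h0 h1).toL1 _ -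
      duhamelL1 hT (bpow l1conv U n) : Edim d →₁[volume] C(Icc (0 : ℝ) T, ℂ)) ξ :=
      Eventually.of_forall fun ξ => by rw [← hU]
    filter_upwards [hne, hU', Lp.coeFn_sub ((integrable_linFlow hT h0 h1).toL1 _)
      (duhamelL1 hT (bpow l1conv U n)), Integrable.coeFn_toL1 (integrable_linFlow hT h0 h1),
      coeFn_duhamelL1 hT (bpow l1conv U n), ae_bpow_apply_eq_convIter U n]
      with ξ a1 a2 a3 a4 a5 a6
    have hr : ‖ξ‖ ≠ 0 := norm_ne_zero_iff.2 a1
    rw [a2, a3, Pi.sub_apply, a4, a5, ContinuousMap.sub_apply, linFlow_apply, duhamel_apply,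
      projIcc_of_mem hT ht]
    have e : Psym t ‖ξ‖ * V1sym t ‖ξ‖ = Wcont t ‖ξ‖ := Wsym_eq_Wcont hr t
    rw [e]
    congr 1
    refine intervalIntegral.integral_congr fun t' _ => ?_
    simp only
    rw [a6, Wsym_eq_Wcont hr]
    rfl

end Solution

section PositiveConvolution

variable {d : ℕ}

/-- The `(n+1)`-fold convolution of a nonnegative function, as a Lebesgue integral. -/
def lconvPow (p : Edim d → ℝ≥0∞) : ℕ → Edim d → ℝ≥0∞
  | 0 => p
  | n + 1 => fun ξ => ∫⁻ η, lconvPow p n (ξ - η) * p η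

lemma measurable_lconvPow {p : Edim d → ℝ≥0∞} (hp : Measurable p) (n : ℕ) :
    Measurable (lconvPow p n) := by
  induction n with
  | zero => exact hp
  | succ n ih =>
    exact Measurable.lintegral_prod_right' (f := fun q : Edim d × Edim d =>
      lconvPow p n (q.1 - q.2) * p q.2) (by fun_prop)

lemma lintegral_lconvPow {p : Edim d → ℝ≥0∞} (hp : Measurable p) (n : ℕ) :
    ∫⁻ ξ, lconvPow p n ξ = (∫⁻ ξ, p ξ) ^ (n + 1) := by
  induction n with
  | zero => simp [lconvPow]
  | succ n ih =>
    have hm := measurable_lconvPow hp n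
    simp only [lconvPow]
    rw [lintegral_lintegral_swap (by fun_prop)]
    have h (η : Edim d) : ∫⁻ ξ, lconvPow p n (ξ - η) * p η = (∫⁻ ξ, p ξ) ^ (n + 1) * p η := by
      rw [lintegral_mul_const _ (by fun_prop), lintegral_sub_right_eq_self (lconvPow p n) η, ih]
    simp_rw [h]
    rw [lintegral_const_mul _ hp, pow_succ _ (n + 1)]

lemma ae_convIter_eq_lconvPow {p : Edim d → ℝ≥0∞} (hp : Measurable p) (hfin : ∫⁻ ξ, p ξ ≠ ⊤)
    (n : ℕ) : ∀ᵐ ξ, lconvPow p n ξ < ⊤ ∧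
      convIter d (fun ξ => ((p ξ).toReal : ℂ)) n ξ = ((lconvPow p n ξ).toReal : ℂ) := by
  have hlt (n : ℕ) : ∀ᵐ ξ, lconvPow p n ξ < ⊤ :=
    ae_lt_top (measurable_lconvPow hp n) (by
      rw [lintegral_lconvPow hp]; exact ENNReal.pow_ne_top hfin)
  induction n with
  | zero =>
    filter_upwards [hlt 0] with ξ h
    exact ⟨h, rfl⟩
  | succ n ih =>
    have hm := measurable_lconvPow hp n
    filter_upwards [hlt (n + 1)] with ξ h
    refine ⟨h, ?_⟩
    have hmeas : Measurable fun η => lconvPow p n (ξ - η) * p η := by fun_prop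
    have hae : ∀ᵐ η, lconvPow p n (ξ - η) * p η < ⊤ := ae_lt_top hmeas h.ne
    rw [lconvPow, ← integral_toReal hmeas.aemeasurable hae, convIter, conv, ← integral_complex_ofReal]
    refine integral_congr_ae ?_
    filter_upwards [ae_comp_sub_left ih ξ] with η h1
    rw [h1.2, ENNReal.toReal_mul, Complex.ofReal_mul]

lemma mul_setLIntegral_ball_le {h p : Edim d → ℝ≥0∞} (hh : Measurable h) (hp : Measurable p)
    (a b : Edim d) (r s : ℝ) :
    (∫⁻ ξ in Metric.ball a r, h ξ) * ∫⁻ ξ in Metric.ball b s, p ξ ≤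
      ∫⁻ ξ in Metric.ball (a + b) (r + s), ∫⁻ η, h (ξ - η) * p η := by
  rw [lintegral_lintegral_swap (by fun_prop), ← lintegral_const_mul _ hp]
  refine le_trans ?_ (setLIntegral_le_lintegral (Metric.ball b s) _)
  refine setLIntegral_mono_ae (by
    refine (Measurable.lintegral_prod_right' (f := fun q : Edim d × Edim d =>
      h (q.2 - q.1) * p q.1) (by fun_prop)).aemeasurable) (Eventually.of_forall fun η hη => ?_)
  rw [lintegral_mul_const _ (by fun_prop)]
  refine mul_le_mul_left ?_ _
  rw [← lintegral_indicator Metric.isOpen_ball.measurableSet,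
    ← lintegral_indicator Metric.isOpen_ball.measurableSet,
    ← lintegral_sub_right_eq_self (indicator (Metric.ball a r) h) η]
  refine lintegral_mono fun ξ => ?_
  by_cases hξ : ξ - η ∈ Metric.ball a r
  · have : ξ ∈ Metric.ball (a + b) (r + s) := by
      rw [mem_ball_iff_norm] at hξ hη ⊢
      calc ‖ξ - (a + b)‖ = ‖(ξ - η - a) + (η - b)‖ := by congr 1; abel
        _ ≤ ‖ξ - η - a‖ + ‖η - b‖ := norm_add_le _ _
        _ < r + s := by gcongr
    rw [indicator_of_mem hξ, indicator_of_mem this]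
  · rw [indicator_of_notMem hξ]
    exact zero_le

lemma pow_setLIntegral_ball_le {p : Edim d → ℝ≥0∞} (hp : Measurable p) (a : Edim d) (r : ℝ)
    (n : ℕ) : (∫⁻ ξ in Metric.ball a r, p ξ) ^ (n + 1) ≤
      ∫⁻ ξ in Metric.ball (((n : ℝ) + 1) • a) (((n : ℝ) + 1) * r), lconvPow p n ξ := by
  induction n with
  | zero => simp [lconvPow]
  | succ n ih =>
    rw [pow_succ]
    refine (mul_le_mul_left ih _).trans ?_
    refine (mul_setLIntegral_ball_le (measurable_lconvPow hp n) hp _ a _ r).trans (le_of_eq ?_)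
    have e1 : ((n : ℝ) + 1) • a + a = (((n + 1 : ℕ) : ℝ) + 1) • a := by
      push_cast; module
    have e2 : ((n : ℝ) + 1) * r + r = (((n + 1 : ℕ) : ℝ) + 1) * r := by
      push_cast; ring
    rw [e1, e2]
    rfl

end PositiveConvolution

section LowFrequency

variable {d : ℕ} {T : ℝ}

lemma norm_linFlow_sub_const_le (hT : 0 ≤ T) {r Λ : ℝ} (hr : 0 ≤ r) (hΛ : Λ * T ≤ 1) (a b c : ℂ)
    (hc : c ≠ 0 → r ≤ Λ) :
    ‖linFlow T (r, a + c, b) - ContinuousMap.const _ c‖ ≤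
      2 * ‖a‖ + T * ‖b‖ + 3 * (Λ * T) * ‖c‖ := by
  have hconst : ‖linFlow T (r, c, 0) - ContinuousMap.const _ c‖ ≤ 3 * (Λ * T) * ‖c‖ := by
    by_cases h0 : c = 0
    · have : linFlow T (r, 0, 0) = 0 := by ext t; simp [linFlow_apply]
      simp [h0, this]
    have hrΛ := hc h0
    have hΛ0 : 0 ≤ Λ := hr.trans hrΛ
    rw [ContinuousMap.norm_le _ (by positivity)]
    rintro ⟨t, ht0, htT⟩
    rw [ContinuousMap.sub_apply, linFlow_apply, ContinuousMap.const_apply]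
    have e : (PV0 t r : ℂ) * c + (Wcont t r : ℂ) * 0 - c = ((PV0 t r - 1 : ℝ) : ℂ) * c := by
      push_cast; ring
    have hrt : r * t ≤ Λ * T := by gcongr
    simp only
    rw [e, norm_mul, Complex.norm_real, Real.norm_eq_abs]
    gcongr
    exact (abs_PV0_sub_one_le ht0 hr (hrt.trans hΛ)).trans (by gcongr)
  have e : linFlow T (r, a + c, b) - ContinuousMap.const _ c
      = linFlow T (r, a, b) + (linFlow T (r, c, 0) - ContinuousMap.const _ c) := by
    ext t
    simp only [ContinuousMap.sub_apply, ContinuousMap.add_apply, linFlow_apply,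
      ContinuousMap.const_apply]
    ring
  rw [e]
  exact (norm_add_le _ _).trans (add_le_add (norm_linFlow_le hT hr a b) hconst)

lemma ofReal_add_three_le {a b c e : ℝ} (hb : 0 ≤ b) (hc : 0 ≤ c) (he : 0 ≤ e)
    (h : a ≤ b + c + e) :
    ENNReal.ofReal a ≤ ENNReal.ofReal b + ENNReal.ofReal c + ENNReal.ofReal e := by
  rw [← ENNReal.ofReal_add hb hc, ← ENNReal.ofReal_add (by positivity) he]
  exact ENNReal.ofReal_le_ofReal h

lemma ae_convIter_congr {K : Type*} {f : K → Edim d → ℂ} {g : Edim d → ℂ}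
    (h : ∀ᵐ ξ, ∀ t, f t ξ = g ξ) (n : ℕ) :
    ∀ᵐ ξ, ∀ t, convIter d (f t) n ξ = convIter d g n ξ := by
  induction n with
  | zero => exact h
  | succ n ih =>
    refine Eventually.of_forall fun ξ t => integral_congr_ae ?_
    filter_upwards [ae_comp_sub_left ih ξ, h] with η h1 h2
    rw [h1, h2]

lemma exists_solution_low_frequency (hd : 1 ≤ d) (hT : 0 ≤ T) {F₀ F₁ : Edim d → ℂ}
    (h0 : Integrable F₀) (h1 : Integrable F₁) {p : Edim d → ℝ≥0∞} (hp : Measurable p)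
    (hptop : ∀ ξ, p ξ ≠ ⊤) {M η CF Λ : ℝ} (hM : 0 ≤ M) (hpM : ∫⁻ ξ, p ξ = ENNReal.ofReal M)
    (hCF : 2 * (∫ ξ, ‖F₀ ξ‖) + T * ∫ ξ, ‖F₁ ξ‖ ≤ CF) (hΛT : Λ * T ≤ 1)
    (hsupp : ∀ ξ, p ξ ≠ 0 → ‖ξ‖ ≤ Λ) (hη : CF + 3 * (Λ * T) * M ≤ η * M) (hη1 : η ≤ 1)
    {n : ℕ} (hsmall : T ^ 2 * (n + 1) * (4 * M) ^ n ≤ 1 / 2)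
    {S : Set (Edim d)} (hS : MeasurableSet S) (hSp : ∀ ξ ∈ S, p ξ = 0)
    (hST : ∀ ξ ∈ S, ‖ξ‖ * T ≤ 1 / 2) :
    ∃ u, IsDuhamelSolution d (n + 1) T (fun ξ => F₀ ξ + ((p ξ).toReal : ℂ)) F₁ u ∧
      ENNReal.ofReal (T ^ 2 / 4) * ∫⁻ ξ in S, lconvPow p n ξ ≤
        (∫⁻ ξ in S, ‖u T ξ‖ₑ) + ENNReal.ofReal CF + ENNReal.ofReal (T ^ 2 *
          ((n + 1) * (4 * M) ^ n * (η * M + T ^ 2 * (4 * M) ^ (n + 1)))) := by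
  have hFi : Integrable fun ξ => 2 * ‖F₀ ξ‖ + T * ‖F₁ ξ‖ :=
    (h0.norm.const_mul _).add (h1.norm.const_mul _)
  have hpfin : ∫⁻ ξ, p ξ ≠ ⊤ := by simp [hpM]
  have hpi : Integrable fun ξ => (p ξ).toReal :=
    integrable_toReal_of_lintegral_ne_top hp.aemeasurable hpfin
  have hpint : ∫ ξ, (p ξ).toReal = M := by
    rw [integral_toReal hp.aemeasurable (Eventually.of_forall fun ξ => (hptop ξ).lt_top), hpM,
      ENNReal.toReal_ofReal hM]
  have hG : Integrable fun ξ => F₀ ξ + ((p ξ).toReal : ℂ) := h0.add hpi.ofReal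
  have hci : Integrable fun ξ =>
      (ContinuousMap.const (Icc (0 : ℝ) T) ((p ξ).toReal : ℂ) : C(Icc (0 : ℝ) T, ℂ)) := by
    refine Integrable.mono' hpi ?_ (Eventually.of_forall fun ξ => ?_)
    · exact ContinuousMap.continuous_const'.comp_aestronglyMeasurable hpi.ofReal.1
    · rw [ContinuousMap.norm_le _ (by positivity)]
      intro t
      simp
  set φ : Edim d →₁[volume] C(Icc (0 : ℝ) T, ℂ) := hci.toL1 _ with hφ
  have hφc := Integrable.coeFn_toL1 hci
  rw [← hφ] at hφc
  have hφM : ‖φ‖ ≤ M := by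
    rw [L1.norm_eq_integral_norm, ← hpint]
    refine integral_mono_ae (L1.integrable_coeFn φ).norm hpi ?_
    filter_upwards [hφc] with ξ h
    rw [h, ContinuousMap.norm_le _ (by positivity)]
    intro t
    simp
  set x₀ := (integrable_linFlow hT hG h1).toL1 _ with hx₀
  have hx₀c := Integrable.coeFn_toL1 (integrable_linFlow hT hG h1)
  rw [← hx₀] at hx₀c
  have he : ‖x₀ - φ‖ ≤ η * M := by
    refine le_trans ?_ hη
    refine le_trans ?_ (add_le_add_left hCF _)
    rw [L1.norm_eq_integral_norm, ← hpint, ← integral_const_mul, ← integral_const_mul,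
      ← integral_const_mul, ← integral_add (h0.norm.const_mul _) (h1.norm.const_mul _),
      ← integral_add hFi (hpi.const_mul _)]
    refine integral_mono_ae (L1.integrable_coeFn _).norm
      (hFi.add (hpi.const_mul _)) ?_
    filter_upwards [Lp.coeFn_sub x₀ φ, hφc, hx₀c] with ξ a1 a2 a3
    rw [a1, Pi.sub_apply, a2, a3]
    have := norm_linFlow_sub_const_le hT (norm_nonneg ξ) hΛT (F₀ ξ) (F₁ ξ) ((p ξ).toReal : ℂ)
      (fun h => hsupp ξ fun h' => h (by simp [h']))
    simpa using this
  have hx₀M : ‖x₀‖ ≤ 2 * M := by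
    calc ‖x₀‖ = ‖(x₀ - φ) + φ‖ := by rw [sub_add_cancel]
      _ ≤ ‖x₀ - φ‖ + ‖φ‖ := norm_add_le _ _
      _ ≤ 1 * M + M := add_le_add (he.trans (by gcongr)) hφM
      _ = 2 * M := by ring
  have h4 : 2 * (2 * M) = 4 * M := by ring
  obtain ⟨U, hUM, hU⟩ := exists_fixedPoint_sub_bpow norm_l1conv_le l1conv_sub_left
    l1conv_sub_right (norm_duhamelL1_le hT) (duhamelL1_sub hT) (sq_nonneg T) (by rwa [h4]) hx₀M
  rw [h4] at hUM
  refine ⟨_, isDuhamelSolution_of_fixedPoint hd hT hG h1 hU, ?_⟩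
  have hUφ : ‖U - φ‖ ≤ η * M + T ^ 2 * (4 * M) ^ (n + 1) := by
    have e : U - φ = (x₀ - φ) - duhamelL1 hT (bpow l1conv U n) := by
      nth_rewrite 1 [hU]; abel
    rw [e]
    refine (norm_sub_le _ _).trans (add_le_add he ?_)
    refine (norm_duhamelL1_le hT _).trans ?_
    gcongr
    exact (norm_bpow_le norm_l1conv_le U n).trans (by gcongr)
  set R := bpow l1conv U n - bpow l1conv φ n with hR
  have hRn : ‖R‖ ≤ (n + 1) * (4 * M) ^ n * (η * M + T ^ 2 * (4 * M) ^ (n + 1)) :=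
    (norm_bpow_sub_le norm_l1conv_le l1conv_sub_left l1conv_sub_right hUM
      (hφM.trans (by linarith)) n).trans (by gcongr)
  have hUx : U =ᵐ[volume] (x₀ - duhamelL1 hT (bpow l1conv U n) :
      Edim d →₁[volume] C(Icc (0 : ℝ) T, ℂ)) := by rw [← hU]
  have hφpow : ∀ᵐ ξ, lconvPow p n ξ < ⊤ ∧
      ∀ t, bpow l1conv φ n ξ t = ((lconvPow p n ξ).toReal : ℂ) := by
    have hφp : ∀ᵐ ξ, ∀ t, φ ξ t = ((p ξ).toReal : ℂ) := by
      filter_upwards [hφc] with ξ h t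
      rw [h, ContinuousMap.const_apply]
    filter_upwards [ae_convIter_eq_lconvPow hp hpfin n, ae_bpow_apply_eq_convIter φ n,
      ae_convIter_congr (f := fun t ξ => φ ξ t) hφp n] with ξ b1 b2 b3
    exact ⟨b1.1, fun t => by rw [b2, b3, b1.2]⟩
  have hkey : ∀ᵐ ξ, ξ ∈ S → ENNReal.ofReal (T ^ 2 / 4) * lconvPow p n ξ ≤
      ‖U ξ (projIcc 0 T hT T)‖ₑ + ENNReal.ofReal (2 * ‖F₀ ξ‖ + T * ‖F₁ ξ‖)
        + ENNReal.ofReal (T ^ 2 * ‖R ξ‖) := by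
    filter_upwards [hφpow, hUx, Lp.coeFn_sub x₀ (duhamelL1 hT (bpow l1conv U n)), hx₀c,
      coeFn_duhamelL1 hT (bpow l1conv U n), Lp.coeFn_sub (bpow l1conv U n) (bpow l1conv φ n)]
      with ξ ⟨a0, a1⟩ a2 a3 a4 a5 a6 hξ
    rw [a3, Pi.sub_apply, a4, a5] at a2
    have hlow := le_norm_duhamel_const hT (norm_nonneg ξ) (hST ξ hξ) a1
    have e : duhamel hT (‖ξ‖, bpow l1conv φ n ξ)
        = linFlow T (‖ξ‖, F₀ ξ + ((p ξ).toReal : ℂ), F₁ ξ) - U ξ - duhamel hT (‖ξ‖, R ξ) := by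
      rw [a2, hR, a6, Pi.sub_apply, duhamel_sub]; abel
    rw [e, hSp ξ hξ, ContinuousMap.sub_apply, ContinuousMap.sub_apply] at hlow
    have hproj : projIcc 0 T hT T = ⟨T, hT, le_rfl⟩ := projIcc_right hT
    rw [hproj, ← ENNReal.ofReal_toReal a0.ne, ← ENNReal.ofReal_mul (by positivity),
      ← ofReal_norm]
    refine ofReal_add_three_le (norm_nonneg _) (by positivity) (by positivity) ?_
    rw [Complex.norm_real, Real.norm_of_nonneg ENNReal.toReal_nonneg] at hlow
    refine hlow.trans ?_
    have b1 : ‖linFlow T (‖ξ‖, F₀ ξ + ((0 : ℝ≥0∞).toReal : ℂ), F₁ ξ) ⟨T, hT, le_rfl⟩‖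
        ≤ 2 * ‖F₀ ξ‖ + T * ‖F₁ ξ‖ := by
      refine (ContinuousMap.norm_coe_le_norm _ _).trans ?_
      simpa using norm_linFlow_le hT (norm_nonneg ξ) (F₀ ξ) (F₁ ξ)
    have b2 : ‖duhamel hT (‖ξ‖, R ξ) ⟨T, hT, le_rfl⟩‖ ≤ T ^ 2 * ‖R ξ‖ :=
      (ContinuousMap.norm_coe_le_norm _ _).trans (norm_duhamel_le hT (norm_nonneg ξ) _)
    refine (norm_sub_le _ _).trans ?_
    refine (add_le_add ((norm_sub_le _ _).trans (add_le_add b1 le_rfl)) b2).trans (le_of_eq ?_)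
    ring
  have hmU : Measurable fun ξ => ‖U ξ (projIcc 0 T hT T)‖ₑ :=
    ((continuous_eval_const (projIcc 0 T hT T)).comp_stronglyMeasurable
      (L1.stronglyMeasurable_coeFn U)).measurable.enorm
  rw [← lintegral_const_mul _ (measurable_lconvPow hp n)]
  refine (setLIntegral_mono_ae' hS hkey).trans ?_
  rw [lintegral_add_left' ?_, lintegral_add_left' ?_]
  · refine add_le_add (add_le_add le_rfl ?_) ?_
    · refine (setLIntegral_le_lintegral _ _).trans ?_
      rw [← ofReal_integral_eq_lintegral_ofReal hFi
        (Eventually.of_forall fun ξ => by positivity)]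
      refine ENNReal.ofReal_le_ofReal (le_trans (le_of_eq ?_) hCF)
      rw [integral_add (h0.norm.const_mul _) (h1.norm.const_mul _), integral_const_mul,
        integral_const_mul]
    · refine (setLIntegral_le_lintegral _ _).trans ?_
      rw [← ofReal_integral_eq_lintegral_ofReal ((L1.integrable_coeFn R).norm.const_mul _)
        (Eventually.of_forall fun ξ => by positivity), integral_const_mul,
        ← L1.norm_eq_integral_norm]
      gcongr
  · exact hmU.aemeasurable
  · exact (hmU.aemeasurable.add hFi.1.aemeasurable.ennreal_ofReal.restrict)

end LowFrequency

section Sobolev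

variable {d : ℕ} {s : ℝ}

lemma measurable_HsWeight (s : ℝ) : Measurable fun ξ : Edim d => (1 + ‖ξ‖ ^ 2) ^ s := by
  fun_prop

lemma HsNormSq_add_le {F G : Edim d → ℂ} (hF : Measurable F) :
    HsNormSq d s (fun ξ => F ξ + G ξ) ≤ 2 * HsNormSq d s F + 2 * HsNormSq d s G := by
  have hw := measurable_HsWeight (d := d) s
  unfold HsNormSq
  rw [← lintegral_const_mul' _ _ (by simp), ← lintegral_const_mul' _ _ (by simp),
    ← lintegral_add_left (by fun_prop)]
  refine lintegral_mono fun ξ => ?_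
  have h2 (x : ℝ) : 2 * ENNReal.ofReal x = ENNReal.ofReal (2 * x) := by
    rw [ENNReal.ofReal_mul zero_le_two, ENNReal.ofReal_ofNat]
  rw [h2, h2, ← ENNReal.ofReal_add (by positivity) (by positivity)]
  refine ENNReal.ofReal_le_ofReal ?_
  have h := norm_add_le (F ξ) (G ξ)
  have h3 : ‖F ξ + G ξ‖ ^ 2 ≤ 2 * ‖F ξ‖ ^ 2 + 2 * ‖G ξ‖ ^ 2 := by
    nlinarith [sq_nonneg (‖F ξ‖ - ‖G ξ‖), norm_nonneg (F ξ + G ξ)]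
  calc (1 + ‖ξ‖ ^ 2) ^ s * ‖F ξ + G ξ‖ ^ 2
      ≤ (1 + ‖ξ‖ ^ 2) ^ s * (2 * ‖F ξ‖ ^ 2 + 2 * ‖G ξ‖ ^ 2) := by gcongr
    _ = _ := by ring

lemma MemHs.exists_integrable_approx {F : Edim d → ℂ} (hF : MemHs d s F) {κ : ℝ≥0∞}
    (hκ : 0 < κ) : ∃ F' : Edim d → ℂ, Integrable F' ∧ MemHs d s F' ∧
      HsNormSq d s (fun ξ => F' ξ - F ξ) < κ := by
  obtain ⟨hm, hfin⟩ := hF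
  have hw := measurable_HsWeight (d := d) s
  set A : ℕ → Set (Edim d) := fun m => {ξ | ‖ξ‖ ≤ m ∧ ‖F ξ‖ ≤ m} with hA
  have hAm (m : ℕ) : MeasurableSet (A m) :=
    (measurableSet_le measurable_norm measurable_const).inter
      (measurableSet_le hm.norm measurable_const)
  have hlim : Tendsto (fun m => HsNormSq d s fun ξ => (A m).indicator F ξ - F ξ) atTop
      (𝓝 (∫⁻ _ : Edim d, 0)) := by
    refine tendsto_lintegral_of_dominated_convergence
      (fun ξ => ENNReal.ofReal ((1 + ‖ξ‖ ^ 2) ^ s * ‖F ξ‖ ^ 2)) (fun m => ?_)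
      (fun m => Eventually.of_forall fun ξ => ?_) hfin.ne (Eventually.of_forall fun ξ => ?_)
    · have := hm.indicator (hAm m)
      fun_prop
    · dsimp only
      gcongr
      by_cases h : ξ ∈ A m <;> simp [h]
    · obtain ⟨m, hm⟩ := exists_nat_ge (max ‖ξ‖ ‖F ξ‖)
      refine tendsto_const_nhds.congr' ?_
      filter_upwards [eventually_ge_atTop m] with l hl
      have hl' : (m : ℝ) ≤ l := by exact_mod_cast hl
      have : ξ ∈ A l := ⟨((le_max_left _ _).trans hm).trans hl', ((le_max_right _ _).trans hm).trans hl'⟩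
      simp [this]
  rw [lintegral_zero] at hlim
  obtain ⟨m, hm'⟩ := (hlim.eventually (gt_mem_nhds hκ)).exists
  refine ⟨(A m).indicator F, ?_, ⟨hm.indicator (hAm m), lt_of_le_of_lt ?_ hfin⟩, hm'⟩
  · rw [integrable_indicator_iff (hAm m)]
    refine Measure.integrableOn_of_bounded (M := m) ?_ hm.aestronglyMeasurable ?_
    · refine ((measure_mono fun ξ hξ => ?_).trans_lt
        (measure_closedBall_lt_top (x := (0 : Edim d)) (r := m))).ne
      simpa using hξ.1
    · rw [ae_restrict_iff' (hAm m)]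
      exact Eventually.of_forall fun ξ hξ => hξ.2
  · refine lintegral_mono fun ξ => ?_
    dsimp only
    gcongr
    exact norm_indicator_le_norm_self _ _

lemma HsNormSq_toReal_le {p : Edim d → ℝ≥0∞} {L Q : ℝ} (hs : s ≤ 0) (hL : 0 < L)
    (hsupp : ∀ ξ, p ξ ≠ 0 → L ≤ ‖ξ‖) (hQ : 0 ≤ Q) (hpQ : ∀ ξ, p ξ ≤ ENNReal.ofReal Q) :
    HsNormSq d s (fun ξ => ((p ξ).toReal : ℂ)) ≤
      ENNReal.ofReal ((L ^ 2) ^ s * Q) * ∫⁻ ξ, p ξ := by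
  rw [← lintegral_const_mul' _ _ (by simp)]
  refine lintegral_mono fun ξ => ?_
  by_cases h0 : p ξ = 0
  · simp [h0]
  have htop : p ξ ≠ ⊤ := ne_top_of_le_ne_top ENNReal.ofReal_ne_top (hpQ ξ)
  have hpQ' : (p ξ).toReal ≤ Q := ENNReal.toReal_le_of_le_ofReal hQ (hpQ ξ)
  conv_rhs => rw [← ENNReal.ofReal_toReal htop, ← ENNReal.ofReal_mul (by positivity)]
  refine ENNReal.ofReal_le_ofReal ?_
  rw [Complex.norm_real, Real.norm_of_nonneg ENNReal.toReal_nonneg, pow_two (p ξ).toReal, mul_assoc]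
  gcongr ?_ * (?_ * _)
  refine Real.rpow_le_rpow_of_nonpos (by positivity) ?_ hs
  have := hsupp ξ h0
  nlinarith

lemma ofReal_lt_HsNorm {f : Edim d → ℂ} (hf : Measurable f) {ρ V x y : ℝ}
    (hs : s ≤ 0) (hV : volume (Metric.ball (0 : Edim d) ρ) ≤ ENNReal.ofReal V) (hV0 : 0 ≤ V)
    (hx : 0 ≤ x) (hfx : ENNReal.ofReal x ≤ ∫⁻ ξ in Metric.ball 0 ρ, ‖f ξ‖ₑ) (hy : 0 ≤ y)
    (h : y ^ 2 * V * (1 + ρ ^ 2) ^ (-s) < x ^ 2) :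
    ENNReal.ofReal y < HsNorm d s f := by
  by_contra! hcon
  have hH : HsNormSq d s f ≤ ENNReal.ofReal (y ^ 2) := by
    have h1 : HsNormSq d s f = HsNorm d s f ^ (2 : ℝ) := by
      rw [HsNorm, ← ENNReal.rpow_mul]; norm_num
    rw [h1, ENNReal.ofReal_pow hy, ← ENNReal.rpow_two]
    gcongr
  have hsq : ∫⁻ ξ in Metric.ball 0 ρ, ‖f ξ‖ₑ ^ (2 : ℝ) ≤
      ENNReal.ofReal ((1 + ρ ^ 2) ^ (-s)) * HsNormSq d s f := by
    refine le_trans ?_ (mul_le_mul_right (setLIntegral_le_lintegral (Metric.ball 0 ρ) _) _)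
    rw [← lintegral_const_mul' _ _ (by simp)]
    refine setLIntegral_mono' Metric.isOpen_ball.measurableSet fun ξ hξ => ?_
    rw [mem_ball_zero_iff] at hξ
    rw [← ENNReal.ofReal_mul (by positivity), ENNReal.rpow_two, ← ofReal_norm,
      ← ENNReal.ofReal_pow (norm_nonneg _), ← mul_assoc]
    refine ENNReal.ofReal_le_ofReal ?_
    refine le_mul_of_one_le_left (by positivity) ?_
    rw [Real.rpow_neg (by positivity), inv_mul_eq_div, one_le_div (by positivity)]
    refine Real.rpow_le_rpow_of_nonpos (by positivity) ?_ hs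
    gcongr
  have hCS := ENNReal.lintegral_mul_le_Lp_mul_Lq (volume.restrict (Metric.ball (0 : Edim d) ρ))
    (p := 2) (q := 2) ⟨by norm_num, by norm_num, by norm_num⟩ hf.enorm.aemeasurable
    (g := fun _ => 1) aemeasurable_const
  simp only [Pi.mul_apply, mul_one, ENNReal.one_rpow, lintegral_const, Measure.restrict_apply_univ,
    one_mul] at hCS
  have h2 := (hfx.trans hCS).trans (mul_le_mul' (ENNReal.rpow_le_rpow
    (hsq.trans (mul_le_mul_right hH _)) (by norm_num)) (ENNReal.rpow_le_rpow hV (by norm_num)))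
  rw [← ENNReal.mul_rpow_of_nonneg _ _ (by norm_num), ← ENNReal.ofReal_mul (by positivity),
    ← ENNReal.ofReal_mul (by positivity), ENNReal.ofReal_rpow_of_nonneg (by positivity)
    (by norm_num), ENNReal.ofReal_le_ofReal_iff (by positivity), ← Real.sqrt_eq_rpow] at h2
  have h3 := Real.le_sqrt' (x := x) (y := (1 + ρ ^ 2) ^ (-s) * y ^ 2 * V)
  rcases eq_or_lt_of_le hx with h0 | h0
  · rw [← h0] at h
    have : 0 ≤ y ^ 2 * V * (1 + ρ ^ 2) ^ (-s) := by positivity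
    norm_num at h
    linarith
  · have := (h3 h0).1 h2
    linarith [mul_comm (y ^ 2 * V) ((1 + ρ ^ 2) ^ (-s)), mul_assoc ((1 + ρ ^ 2) ^ (-s)) (y ^ 2) V]

end Sobolev

section TwoBumps

variable {d : ℕ}

/-- The profile of height `R` on the two balls of radius `A` centred at `a` and `b`. -/
def twoBumps (a b : Edim d) (A R : ℝ) (ξ : Edim d) : ℝ≥0∞ :=
  (Metric.ball a A).indicator (fun _ => ENNReal.ofReal R) ξ
    + (Metric.ball b A).indicator (fun _ => ENNReal.ofReal R) ξ

lemma measurable_twoBumps (a b : Edim d) (A R : ℝ) : Measurable (twoBumps a b A R) :=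
  (measurable_const.indicator Metric.isOpen_ball.measurableSet).add
    (measurable_const.indicator Metric.isOpen_ball.measurableSet)

lemma mem_of_twoBumps_ne_zero {a b : Edim d} {A R : ℝ} {ξ : Edim d}
    (h : twoBumps a b A R ξ ≠ 0) : ξ ∈ Metric.ball a A ∨ ξ ∈ Metric.ball b A := by
  by_contra! hc
  exact h (by simp [twoBumps, hc.1, hc.2])

lemma twoBumps_le {a b : Edim d} {A R : ℝ} (hR : 0 ≤ R) (ξ : Edim d) :
    twoBumps a b A R ξ ≤ ENNReal.ofReal (2 * R) := by
  rw [two_mul, ENNReal.ofReal_add hR hR]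
  exact add_le_add (indicator_le_self _ _ _) (indicator_le_self _ _ _)

/-- The volume of the unit ball. -/
def unitBallVol (d : ℕ) : ℝ := (volume (Metric.ball (0 : Edim d) 1)).toReal

lemma unitBallVol_pos (d : ℕ) : 0 < unitBallVol d :=
  ENNReal.toReal_pos (Metric.measure_ball_pos _ _ one_pos).ne' measure_ball_lt_top.ne

lemma volume_ball_eq (a : Edim d) {r : ℝ} (hr : 0 < r) :
    volume (Metric.ball a r) = ENNReal.ofReal (r ^ d * unitBallVol d) := by
  rw [Measure.addHaar_ball_of_pos _ _ hr, finrank_euclideanSpace_fin, ENNReal.ofReal_mul (by positivity),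
    unitBallVol, ENNReal.ofReal_toReal measure_ball_lt_top.ne]

lemma lintegral_twoBumps (a b : Edim d) {A R m : ℝ} (hA : 0 < A) (hR : 0 ≤ R)
    (hm : R * (A ^ d * unitBallVol d) = m) :
    ∫⁻ ξ, twoBumps a b A R ξ = ENNReal.ofReal (2 * m) := by
  have hV := unitBallVol_pos d
  have hm0 : 0 ≤ m := by rw [← hm]; positivity
  simp only [twoBumps]
  rw [lintegral_add_left (measurable_const.indicator Metric.isOpen_ball.measurableSet),
    lintegral_indicator_const Metric.isOpen_ball.measurableSet,
    lintegral_indicator_const Metric.isOpen_ball.measurableSet, volume_ball_eq a hA,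
    volume_ball_eq b hA, ← ENNReal.ofReal_mul hR, hm, two_mul, ENNReal.ofReal_add hm0 hm0]

lemma le_setLIntegral_twoBumps (a b : Edim d) {A R m : ℝ} (hA : 0 < A) (hR : 0 ≤ R)
    (hm : R * (A ^ d * unitBallVol d) = m) :
    ENNReal.ofReal m ≤ ∫⁻ ξ in Metric.ball a A, twoBumps a b A R ξ ∧
      ENNReal.ofReal m ≤ ∫⁻ ξ in Metric.ball b A, twoBumps a b A R ξ := by
  have h (c : Edim d) : ENNReal.ofReal m = ∫⁻ ξ in Metric.ball c A, ENNReal.ofReal R := by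
    rw [setLIntegral_const, volume_ball_eq c hA, ← ENNReal.ofReal_mul hR, hm]
  constructor
  · rw [h a]
    refine setLIntegral_mono' Metric.isOpen_ball.measurableSet fun ξ hξ => ?_
    rw [twoBumps, indicator_of_mem hξ]
    exact le_self_add
  · rw [h b]
    refine setLIntegral_mono' Metric.isOpen_ball.measurableSet fun ξ hξ => ?_
    rw [twoBumps, indicator_of_mem hξ]
    exact le_add_self

lemma le_setLIntegral_lconvPow_twoBumps (a : Edim d) {A R m : ℝ} (hA : 0 < A) (hR : 0 ≤ R)
    (hm : R * (A ^ d * unitBallVol d) = m) (j : ℕ) :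
    ENNReal.ofReal (m ^ (j + 2)) ≤ ∫⁻ ξ in Metric.ball 0 (((j : ℝ) + 2) * A),
      lconvPow (twoBumps a (-(((j : ℝ) + 1) • a)) A R) (j + 1) ξ := by
  have hV := unitBallVol_pos d
  have hm0 : 0 ≤ m := by rw [← hm]; positivity
  set p := twoBumps a (-(((j : ℝ) + 1) • a)) A R with hpd
  have hp : Measurable p := measurable_twoBumps _ _ _ _
  obtain ⟨h1, h2⟩ := le_setLIntegral_twoBumps a (-(((j : ℝ) + 1) • a)) hA hR hm
  have h3 := mul_setLIntegral_ball_le (measurable_lconvPow hp j) hp (((j : ℝ) + 1) • a)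
    (-(((j : ℝ) + 1) • a)) (((j : ℝ) + 1) * A) A
  have e : ((j : ℝ) + 1) * A + A = ((j : ℝ) + 2) * A := by ring
  rw [add_neg_cancel, e] at h3
  refine le_trans ?_ h3
  rw [pow_succ, ENNReal.ofReal_mul (by positivity), ENNReal.ofReal_pow hm0]
  exact mul_le_mul' ((pow_le_pow_left' h1 _).trans (pow_setLIntegral_ball_le hp a A j)) h2

end TwoBumps

section Parameters

lemma exists_small_constants {l D E β : ℝ} (hl : 2 ≤ l) (hD : 1 ≤ D) (hE : 1 ≤ E) (hβ : 0 < β)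
    (hβ1 : β ≤ 1) : ∃ c δ κ : ℝ, 0 < c ∧ 0 < δ ∧ 0 < κ ∧ κ = δ * β / 4 ∧ D * E * δ = β / 8 ∧
      D * δ ≤ β / 8 ∧ 3 * (l * c) * D = β / 8 ∧ l * c ≤ β / 24 ∧ c ≤ 1 / 2 ∧ κ * D ≤ β / 8 := by
  have hδ : 0 < β / (8 * D * E) := by positivity
  have h1 : D * E * (β / (8 * D * E)) = β / 8 := by field_simp
  have h2 : D * (β / (8 * D * E)) ≤ β / 8 := by
    rw [← h1]
    gcongr
    nlinarith
  have h3 : l * (β / (24 * l * D)) ≤ β / 24 := by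
    have : l * (β / (24 * l * D)) = β / 24 / D := by field_simp
    rw [this]
    exact div_le_self (by positivity) hD
  refine ⟨β / (24 * l * D), β / (8 * D * E), _, by positivity, hδ, by positivity, rfl, h1, h2, ?_,
    h3, ?_, ?_⟩
  · field_simp; norm_num
  · have : 0 < β / (24 * l * D) := by positivity
    nlinarith
  · nlinarith

/-- The scale of the parameters: `A = N^θ`, `T = c / N`, `M ∼ N^(2/n)`, for `N` large. -/
lemma exists_inflation_parameters {d n : ℕ} (hd : 1 ≤ d) (hn : 1 ≤ n) {s : ℝ} (hs0 : s < 0)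
    (hs : s < (d : ℝ) / 2 - 2 / (n : ℝ)) {c δ κ l ω CF ε : ℝ} (hc : 0 < c) (hδ : 0 < δ)
    (hκ : 0 < κ) (hl : 0 < l) (hω : 0 < ω) (hε : 0 < ε) :
    ∃ N A T M : ℝ, 0 < N ∧ 0 < A ∧ 0 < T ∧ 0 < M ∧ T ≤ 1 ∧ T < ε ∧ N * T = c ∧
      T ^ 2 * M ^ n = δ ∧ CF ≤ κ * M ∧ (l + 1) * A ≤ N ∧ A ≤ N / 2 ∧
      ((N / 2) ^ 2) ^ s * (2 * (M / 2 / (A ^ d * ω))) * M < ε ^ 2 / 8 ∧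
      (1 / ε) ^ 2 * ((l * A) ^ d * ω) * (1 + (l * A) ^ 2) ^ (-s) < (κ * M) ^ 2 := by
  have hn' : (0 : ℝ) < n := by exact_mod_cast hn
  have hd' : (0 : ℝ) < d := by exact_mod_cast hd
  set a : ℝ := 2 / n with ha
  have ha0 : 0 < a := by positivity
  obtain ⟨θ, h1, h2⟩ : ∃ θ, max 0 (2 * (a + s) / d) < θ ∧ θ < min 1 (2 * a / (d - 2 * s)) := by
    have hds : 0 < d - 2 * s := by linarith
    refine exists_between (max_lt (lt_min one_pos (by positivity)) (lt_min ?_ ?_))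
    · rw [div_lt_one hd']; linarith
    · rw [div_lt_div_iff₀ hd' hds]
      nlinarith
  have hθ0 : 0 < θ := (le_max_left _ _).trans_lt h1
  have hθ1 : θ < 1 := h2.trans_le (min_le_left _ _)
  have hq : 0 < θ * d - 2 * s - 2 * a := by
    have := (le_max_right _ _).trans_lt h1
    rw [div_lt_iff₀ hd'] at this
    linarith
  have hr : 0 < 2 * a - θ * (d - 2 * s) := by
    have := h2.trans_le (min_le_right _ _)
    rw [lt_div_iff₀ (by linarith)] at this
    linarith
  set K : ℝ := (δ / c ^ 2) ^ (1 / (n : ℝ)) with hK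
  have hK0 : 0 < K := by positivity
  have hKn : K ^ n = δ / c ^ 2 := by
    rw [hK, ← Real.rpow_natCast, ← Real.rpow_mul (by positivity), one_div_mul_cancel hn'.ne',
      Real.rpow_one]
  have e1 : ∀ᶠ N : ℝ in atTop, c / N < min 1 ε :=
    (tendsto_id.const_div_atTop c).eventually (gt_mem_nhds (by positivity))
  have e2 : ∀ᶠ N : ℝ in atTop, CF / (κ * K) ≤ N ^ a :=
    (tendsto_rpow_atTop ha0).eventually_ge_atTop _
  have e3 : ∀ᶠ N : ℝ in atTop, max (l + 1) 2 ≤ N ^ (1 - θ) :=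
    (tendsto_rpow_atTop (by linarith)).eventually_ge_atTop _
  have e4 : ∀ᶠ N : ℝ in atTop,
      (1 / 4) ^ s * K ^ 2 / ω * N ^ (-(θ * d - 2 * s - 2 * a)) < ε ^ 2 / 8 := by
    refine ((tendsto_rpow_neg_atTop hq).const_mul _).eventually (gt_mem_nhds ?_)
    rw [mul_zero]; positivity
  have e5 : ∀ᶠ N : ℝ in atTop, (1 / ε) ^ 2 * (l ^ d * ω) * (1 + l ^ 2) ^ (-s)
      * N ^ (-(2 * a - θ * (d - 2 * s))) < (κ * K) ^ 2 := by
    refine ((tendsto_rpow_neg_atTop hr).const_mul _).eventually (gt_mem_nhds ?_)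
    rw [mul_zero]; positivity
  obtain ⟨N, e1, e2, e3, e4, e5, hN1⟩ :=
    (e1.and (e2.and (e3.and (e4.and (e5.and (eventually_ge_atTop 1)))))).exists
  have hN : 0 < N := by linarith
  have hNθ : N = N ^ (1 - θ) * N ^ θ := by
    rw [← Real.rpow_add hN]; norm_num
  have hA1 : 1 ≤ N ^ θ := Real.one_le_rpow hN1 hθ0.le
  refine ⟨N, N ^ θ, c / N, K * N ^ a, hN, by positivity, by positivity, by positivity,
    (e1.trans_le (min_le_left _ _)).le, e1.trans_le (min_le_right _ _), by field_simp, ?_, ?_, ?_,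
    ?_, ?_, ?_⟩
  · rw [mul_pow, hKn, ← Real.rpow_natCast (N ^ a), ← Real.rpow_mul hN.le, ha,
      div_mul_cancel₀ _ hn'.ne', Real.rpow_two]
    field_simp
  · rw [div_le_iff₀ (by positivity)] at e2
    linarith
  · conv_rhs => rw [hNθ]
    gcongr
    exact (le_max_left _ _).trans e3
  · rw [le_div_iff₀ two_pos, mul_comm]
    conv_rhs => rw [hNθ]
    gcongr
    exact (le_max_right _ _).trans e3
  · refine lt_of_eq_of_lt ?_ e4
    have x1 : ((N / 2) ^ 2) ^ s = (1 / 4) ^ s * N ^ (2 * s) := by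
      rw [Real.rpow_mul hN.le, Real.rpow_two, ← Real.mul_rpow (by norm_num) (by positivity)]
      congr 1; ring
    have x2 : (N ^ θ) ^ d = N ^ (θ * d) := by
      rw [Real.rpow_mul hN.le, Real.rpow_natCast]
    have x3 : N ^ (-(θ * d - 2 * s - 2 * a)) = N ^ (2 * s) * (N ^ a) ^ 2 / N ^ (θ * d) := by
      rw [← Real.rpow_two (N ^ a), ← Real.rpow_mul hN.le, ← Real.rpow_add hN, ← Real.rpow_sub hN]
      congr 1; ring
    rw [x1, x2, x3]
    field_simp
  · have x1 : (1 + (l * N ^ θ) ^ 2) ^ (-s) ≤ (1 + l ^ 2) ^ (-s) * N ^ (θ * (-(2 * s))) := by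
      have : θ * (-(2 * s)) = θ * 2 * (-s) := by ring
      rw [this, Real.rpow_mul hN.le, ← Real.mul_rpow (by positivity) (by positivity),
        Real.rpow_mul hN.le, Real.rpow_two]
      refine Real.rpow_le_rpow (by positivity) ?_ (by linarith)
      nlinarith
    have x2 : (l * N ^ θ) ^ d = l ^ d * N ^ (θ * d) := by
      rw [mul_pow, Real.rpow_mul hN.le, Real.rpow_natCast]
    have x3 : N ^ (θ * d) * N ^ (θ * (-(2 * s)))
        = N ^ (-(2 * a - θ * (d - 2 * s))) * (N ^ a) ^ 2 := by
      rw [← Real.rpow_two (N ^ a), ← Real.rpow_mul hN.le, ← Real.rpow_add hN, ← Real.rpow_add hN]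
      congr 1; ring
    calc (1 / ε) ^ 2 * ((l * N ^ θ) ^ d * ω) * (1 + (l * N ^ θ) ^ 2) ^ (-s)
        ≤ (1 / ε) ^ 2 * ((l * N ^ θ) ^ d * ω) *
          ((1 + l ^ 2) ^ (-s) * N ^ (θ * (-(2 * s)))) := by gcongr
      _ = (1 / ε) ^ 2 * (l ^ d * ω) * (1 + l ^ 2) ^ (-s) *
          (N ^ (θ * d) * N ^ (θ * (-(2 * s)))) := by rw [x2]; ring
      _ = (1 / ε) ^ 2 * (l ^ d * ω) * (1 + l ^ 2) ^ (-s)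
          * N ^ (-(2 * a - θ * (d - 2 * s))) * (N ^ a) ^ 2 := by rw [x3]; ring
      _ < (κ * K) ^ 2 * (N ^ a) ^ 2 := by gcongr
      _ = _ := by ring

end Parameters

section Inflation

variable {d : ℕ} {s : ℝ}

lemma norm_bounds_of_twoBumps_ne_zero {a : Edim d} {A R N l : ℝ} (ha : ‖a‖ = N) (hN : 0 < N)
    (hl : 1 ≤ l) (hAN : A ≤ N) {ξ : Edim d} (h : twoBumps a (-(l • a)) A R ξ ≠ 0) :
    N - A ≤ ‖ξ‖ ∧ ‖ξ‖ ≤ (l + 1) * N := by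
  have key {b : Edim d} (h1 : N ≤ ‖b‖) (h2 : ‖b‖ ≤ l * N) (hb : ξ ∈ Metric.ball b A) :
      N - A ≤ ‖ξ‖ ∧ ‖ξ‖ ≤ (l + 1) * N := by
    rw [mem_ball_iff_norm] at hb
    have h3 := norm_sub_norm_le b ξ
    have h4 := norm_sub_norm_le ξ b
    rw [norm_sub_rev] at h3
    constructor <;> linarith
  rcases mem_of_twoBumps_ne_zero h with hb | hb
  · exact key ha.ge (by rw [ha]; nlinarith) hb
  · have : ‖-(l • a)‖ = l * N := by
      rw [norm_neg, norm_smul, ha, Real.norm_of_nonneg (by linarith)]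
    exact key (by rw [this]; nlinarith) this.le hb

lemma memFLPair_of_integrable {F G : Edim d → ℂ} (hF : Measurable F) (hG : Measurable G)
    (hFi : Integrable F) (hGi : Integrable G) : MemFLPair d F G := by
  refine ⟨hF, hG, ENNReal.add_lt_top.2 ⟨hFi.2, lt_of_le_of_lt (lintegral_mono fun ξ => ?_) hGi.2⟩⟩
  rw [← ofReal_norm]
  refine ENNReal.ofReal_le_ofReal (mul_le_of_le_one_left (norm_nonneg _) ?_)
  exact Real.rpow_le_one_of_one_le_of_nonpos (by nlinarith [norm_nonneg ξ]) (by norm_num)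

lemma pairHsNorm_lt_of_lt {F G : Edim d → ℂ} {ε : ℝ} (hε : 0 ≤ ε)
    (h : HsNormSq d s F + HsNormSq d (s - 1) G < ENNReal.ofReal (ε ^ 2)) :
    pairHsNorm d s F G < ENNReal.ofReal ε := by
  have := ENNReal.rpow_lt_rpow h (z := 1 / 2) (by norm_num)
  rwa [ENNReal.ofReal_rpow_of_nonneg (by positivity) (by norm_num), ← Real.sqrt_eq_rpow,
    Real.sqrt_sq hε] at this

end Inflation

set_option maxHeartbeats 1000000 in
/-- (Theorem 1.1 (1), norm inflation at general initial data,
for `s < min(s_scal, 0)`), on `ℝ^d`, formulated on the Fourier side. -/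
theorem vNLW_norm_inflation_general_data
    (d k : ℕ) (hd : 1 ≤ d) (hk : 2 ≤ k) (s : ℝ)
    (hs : s < min ((d : ℝ) / 2 - 2 / ((k : ℝ) - 1)) 0)
    (F₀ F₁ : Edim d → ℂ) (hF : MemHsPair d s F₀ F₁)
    (ε : ℝ) (hε : 0 < ε) :
    ∃ (G₀ G₁ : Edim d → ℂ) (T : ℝ) (u : ℝ → Edim d → ℂ) (tε : ℝ),
      MemFLPair d G₀ G₁ ∧ MemHsPair d s G₀ G₁ ∧ 0 < T ∧
      IsDuhamelSolution d k T G₀ G₁ u ∧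
      tε ∈ Set.Ioo 0 ε ∧ tε ≤ T ∧
      pairHsNorm d s (fun ξ => G₀ ξ - F₀ ξ) (fun ξ => G₁ ξ - F₁ ξ) < ENNReal.ofReal ε ∧
      ENNReal.ofReal (1 / ε) < HsNorm d s (u tε) := by
  obtain ⟨j, rfl⟩ : ∃ j, k = j + 2 := ⟨k - 2, by omega⟩
  obtain ⟨hs1, hs0⟩ := lt_min_iff.1 hs
  have ej : ((j + 2 : ℕ) : ℝ) - 1 = ((j + 1 : ℕ) : ℝ) := by push_cast; ring
  rw [ej] at hs1
  have hε8 : 0 < ENNReal.ofReal (ε ^ 2 / 8) := ENNReal.ofReal_pos.2 (by positivity)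
  obtain ⟨F₀', hi0, hm0, hlt0⟩ := hF.1.exists_integrable_approx hε8
  obtain ⟨F₁', hi1, hm1, hlt1⟩ := hF.2.exists_integrable_approx hε8
  set CF : ℝ := 2 * (∫ ξ, ‖F₀' ξ‖) + ∫ ξ, ‖F₁' ξ‖ with hCF
  set D : ℝ := ((j : ℝ) + 2) * 4 ^ (j + 1) with hD
  set β : ℝ := 1 / (4 * 2 ^ (j + 2)) with hβ
  have hβ0 : 0 < β := by positivity
  have hβ1 : β ≤ 1 := by
    rw [hβ, div_le_one (by positivity)]
    nlinarith [one_le_pow₀ (M₀ := ℝ) one_le_two (n := j + 2)]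
  have hD1 : 1 ≤ D := by
    rw [hD]
    nlinarith [one_le_pow₀ (M₀ := ℝ) (a := 4) (by norm_num) (n := j + 1),
      (j.cast_nonneg : (0 : ℝ) ≤ j)]
  set l : ℝ := (j : ℝ) + 2 with hl
  have hl2 : 2 ≤ l := by rw [hl]; linarith [(j.cast_nonneg : (0 : ℝ) ≤ j)]
  obtain ⟨c, δ, κ, hc0, hδ0, hκ0, hκ, hDδ4, hDδ, hcD, hlc, hc2, hκD⟩ :=
    exists_small_constants hl2 hD1
      (one_le_pow₀ (by norm_num) : (1 : ℝ) ≤ 4 ^ (j + 2)) hβ0 hβ1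
  obtain ⟨N, A, T, M, hN, hA, hT, hM, hT1, hTε, hNT, hTM, hCM, hAN, hAN2, hsm, hlg⟩ :=
    exists_inflation_parameters (d := d) (n := j + 1) (CF := CF) (l := l) hd (by omega) hs0 hs1 hc0
      hδ0 hκ0 (by linarith) (unitBallVol_pos d) hε
  have hω := unitBallVol_pos d
  set R : ℝ := M / 2 / (A ^ d * unitBallVol d) with hR
  have hR0 : 0 ≤ R := by positivity
  have hRm : R * (A ^ d * unitBallVol d) = M / 2 := by rw [hR]; field_simp
  set e : Edim d := N • EuclideanSpace.single (⟨0, hd⟩ : Fin d) (1 : ℝ) with he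
  have hen : ‖e‖ = N := by
    rw [he, norm_smul, PiLp.norm_single, norm_one, mul_one, Real.norm_of_nonneg hN.le]
  set p : Edim d → ℝ≥0∞ := twoBumps e (-(((j : ℝ) + 1) • e)) A R with hp
  have hpm : Measurable p := measurable_twoBumps _ _ _ _
  have hple (ξ : Edim d) : p ξ ≤ ENNReal.ofReal (2 * R) := twoBumps_le hR0 ξ
  have hptop (ξ : Edim d) : p ξ ≠ ⊤ := ne_top_of_le_ne_top ENNReal.ofReal_ne_top (hple ξ)
  have hpM : ∫⁻ ξ, p ξ = ENNReal.ofReal M := by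
    rw [hp, lintegral_twoBumps _ _ hA hR0 hRm]; congr 1; ring
  have hsupp {ξ : Edim d} (h : p ξ ≠ 0) : N - A ≤ ‖ξ‖ ∧ ‖ξ‖ ≤ l * N := by
    have := norm_bounds_of_twoBumps_ne_zero hen hN (by linarith) (by linarith) h
    refine ⟨this.1, this.2.trans (le_of_eq ?_)⟩
    rw [hl]; ring
  have hΛT : l * N * T = l * c := by rw [← hNT]; ring
  have hTMc : T ^ 2 * (((j + 1 : ℕ) : ℝ) + 1) * (4 * M) ^ (j + 1) = D * δ := by
    rw [← hTM, hD, mul_pow]; push_cast; ring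
  obtain ⟨u, hu, hmass⟩ := exists_solution_low_frequency hd hT.le hi0 hi1 hpm hptop hM.le hpM
    (η := κ + 3 * (l * c)) (CF := CF) (Λ := l * N) (n := j + 1)
    (S := Metric.ball 0 (l * A))
    (by
      have : 0 ≤ ∫ ξ, ‖F₁' ξ‖ := by positivity
      nlinarith)
    (by rw [hΛT]; linarith)
    (fun ξ h => (hsupp h).2)
    (by rw [hΛT]; nlinarith)
    (by nlinarith)
    (by rw [hTMc]; linarith)
    Metric.isOpen_ball.measurableSet
    (fun ξ hξ => by
      by_contra h
      have := (hsupp h).1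
      rw [mem_ball_zero_iff] at hξ
      linarith)
    (fun ξ hξ => by
      rw [mem_ball_zero_iff] at hξ
      have : ‖ξ‖ * T ≤ N * T := by
        gcongr; linarith
      linarith)
  have hlow : ENNReal.ofReal (κ * M) ≤ ∫⁻ ξ in Metric.ball 0 (l * A), ‖u T ξ‖ₑ := by
    have h1 := le_setLIntegral_lconvPow_twoBumps e hA hR0 hRm j
    have h2 := (mul_le_mul_right h1 (ENNReal.ofReal (T ^ 2 / 4))).trans hmass
    rw [← ENNReal.ofReal_mul (by positivity)] at h2
    have x1 : T ^ 2 / 4 * (M / 2) ^ (j + 2) = δ * β * M := by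
      rw [← hTM, hβ, div_pow, pow_succ M (j + 1)]; field_simp
    have x2 : T ^ 2 * ((((j + 1 : ℕ) : ℝ) + 1) * (4 * M) ^ (j + 1) *
        ((κ + 3 * (l * c)) * M + T ^ 2 * (4 * M) ^ (j + 1 + 1)))
        = δ * M * (D * κ + 3 * (l * c) * D + D * 4 ^ (j + 2) * δ) := by
      have : T ^ 2 * (4 * M) ^ (j + 1 + 1) = 4 ^ (j + 2) * δ * M := by
        rw [← hTM]; ring
      rw [this]
      linear_combination ((κ + 3 * (l * c)) * M + 4 ^ (j + 2) * δ * M) * hTMc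
    rw [x1, x2, add_assoc, ← tsub_le_iff_right] at h2
    refine le_trans ?_ h2
    have hb : 0 ≤ δ * M * (D * κ + 3 * (l * c) * D + D * 4 ^ (j + 2) * δ) := by positivity
    have hc' : 0 ≤ CF := by positivity
    rw [← ENNReal.ofReal_add hc' hb, ← ENNReal.ofReal_sub _ (by positivity)]
    refine ENNReal.ofReal_le_ofReal ?_
    have : δ * M * (D * κ + 3 * (l * c) * D + D * 4 ^ (j + 2) * δ) ≤ δ * M * (β / 2) := by
      gcongr; linarith
    have hκ' : κ * M = δ * M * β / 4 := by rw [hκ]; ring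
    linarith
  have hφi : Integrable fun ξ => ((p ξ).toReal : ℂ) :=
    (integrable_toReal_of_lintegral_ne_top hpm.aemeasurable
      (by rw [hpM]; exact ENNReal.ofReal_ne_top)).ofReal
  have hφm : Measurable fun ξ => ((p ξ).toReal : ℂ) :=
    Complex.measurable_ofReal.comp hpm.ennreal_toReal
  have hφs : HsNormSq d s (fun ξ => ((p ξ).toReal : ℂ)) < ENNReal.ofReal (ε ^ 2 / 8) := by
    refine (HsNormSq_toReal_le hs0.le (half_pos hN) (fun ξ h => ?_) (by positivity)
      hple).trans_lt ?_
    · linarith [(hsupp h).1]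
    · rw [hpM, ← ENNReal.ofReal_mul (by positivity)]
      exact (ENNReal.ofReal_lt_ofReal_iff (by positivity)).2 hsm
  have hsub0 : Measurable fun ξ => F₀' ξ - F₀ ξ := hm0.1.sub hF.1.1
  refine ⟨fun ξ => F₀' ξ + ((p ξ).toReal : ℂ), F₁', T, u, T,
    memFLPair_of_integrable (hm0.1.add hφm) hm1.1 (hi0.add hφi) hi1,
    ⟨⟨hm0.1.add hφm, (HsNormSq_add_le hm0.1).trans_lt ?_⟩, hm1⟩, hT, hu, ⟨hT, hTε⟩, le_rfl, ?_, ?_⟩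
  · exact ENNReal.add_lt_top.2 ⟨ENNReal.mul_lt_top (by simp) hm0.2,
      ENNReal.mul_lt_top (by simp) (hφs.trans ENNReal.ofReal_lt_top)⟩
  · refine pairHsNorm_lt_of_lt hε.le ?_
    have h1 := HsNormSq_add_le (s := s) (G := fun ξ => ((p ξ).toReal : ℂ)) hsub0
    have h2 : (fun ξ => F₀' ξ + ((p ξ).toReal : ℂ) - F₀ ξ) =
        fun ξ => F₀' ξ - F₀ ξ + ((p ξ).toReal : ℂ) := by ext ξ; ring
    rw [h2]
    refine (add_le_add (h1.trans (add_le_add (mul_le_mul_right hlt0.le 2)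
      (mul_le_mul_right hφs.le 2))) hlt1.le).trans_lt ?_
    rw [← ENNReal.ofReal_ofNat, ← ENNReal.ofReal_mul (by norm_num),
      ← ENNReal.ofReal_add (by positivity) (by positivity),
      ← ENNReal.ofReal_add (by positivity) (by positivity)]
    refine (ENNReal.ofReal_lt_ofReal_iff (by positivity)).2 ?_
    nlinarith
  · exact ofReal_lt_HsNorm (hu.measurable T ⟨hT.le, le_rfl⟩) hs0.le
      (volume_ball_eq 0 (by positivity)).le (by positivity) (by positivity) hlow (by positivity) hlg

end
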